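/- arXiv:2005.06428 — 3 statements merged into one kernel-verified Lean document; each statement's English description precedes it below -/
import Mathlib

section
/- For a DMC with capacity-achieving input distribution P_X satisfying I(P_X)>0, V(P_X)>0, Var[i(X;Y)|Y]>0, and T(P_X)<∞, for every 0<ε<1 and all sufficiently large n there exists a blocklength-n code with M codewords and average error probability at most ε such that log M ≥ nC − √(nV)·Q⁻¹(ε) + (1/2)log n − O(1), where C is the capacity, V = Var[i(X;Y)], and Q⁻¹ is the inverse of the standard Gaussian complementary CDF. -/
open scoped BigOperators Classical
open MeasureTheory

noncomputable section

/-- Standard Gaussian complementary CDF `Q`. -/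
def Qfun (x : ℝ) : ℝ :=
  (Real.sqrt (2 * Real.pi))⁻¹ * ∫ u in Set.Ioi x, Real.exp (-u ^ 2 / 2)

/-- Expectation of `F` under the product of the weights `p i`. -/
def prodMean {ι A : Type*} [Fintype ι] [DecidableEq ι] [Fintype A]
    (p : ι → A → ℝ) (F : (ι → A) → ℝ) : ℝ :=
  ∑ a : ι → A, (∏ i, p i (a i)) * F a

section ProdMean

variable {ι A : Type*} [Fintype ι] [DecidableEq ι] [Fintype A] {p : ι → A → ℝ}

theorem prodMean_one (hp1 : ∀ i, ∑ a, p i a = 1) : prodMean p (fun _ => 1) = 1 := by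
  simp only [prodMean, mul_one]
  rw [← Fintype.piFinset_univ, ← Finset.prod_univ_sum]
  simp [hp1]

theorem prodMean_mono_of_pos (hp0 : ∀ i a, 0 ≤ p i a) {F G : (ι → A) → ℝ}
    (h : ∀ a, (∀ i, 0 < p i (a i)) → F a ≤ G a) : prodMean p F ≤ prodMean p G := by
  refine Finset.sum_le_sum fun a _ => ?_
  by_cases ha : ∀ i, 0 < p i (a i)
  · exact mul_le_mul_of_nonneg_left (h a ha) (Finset.prod_nonneg fun i _ => hp0 i (a i))
  · push Not at ha
    obtain ⟨i, hi⟩ := ha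
    have : ∏ i, p i (a i) = 0 :=
      Finset.prod_eq_zero (Finset.mem_univ i) (le_antisymm hi (hp0 i (a i)))
    rw [this, zero_mul, zero_mul]

theorem prodMean_mono (hp0 : ∀ i a, 0 ≤ p i a) {F G : (ι → A) → ℝ} (h : ∀ a, F a ≤ G a) :
    prodMean p F ≤ prodMean p G :=
  prodMean_mono_of_pos hp0 fun a _ => h a

theorem prodMean_add (F G : (ι → A) → ℝ) :
    prodMean p (fun a => F a + G a) = prodMean p F + prodMean p G := by
  simp [prodMean, mul_add, Finset.sum_add_distrib]

theorem prodMean_const_mul (c : ℝ) (F : (ι → A) → ℝ) :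
    prodMean p (fun a => c * F a) = c * prodMean p F := by
  simp only [prodMean, Finset.mul_sum]
  exact Finset.sum_congr rfl fun a _ => by ring

theorem prodMean_const (hp1 : ∀ i, ∑ a, p i a = 1) (c : ℝ) : prodMean p (fun _ => c) = c := by
  simpa [prodMean_one hp1] using prodMean_const_mul (p := p) c (fun _ => 1)

theorem prodMean_sum {κ : Type*} (s : Finset κ) (F : κ → (ι → A) → ℝ) :
    prodMean p (fun a => ∑ k ∈ s, F k a) = ∑ k ∈ s, prodMean p (F k) := by
  simp only [prodMean, Finset.mul_sum]
  exact Finset.sum_comm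

/-- Resampling one coordinate does not change the expectation. -/
theorem prodMean_update (k : ι) (hk : ∑ c, p k c = 1) (F : (ι → A) → ℝ) :
    prodMean p F = prodMean p (fun a => ∑ c, p k c * F (Function.update a k c)) := by
  let σ : (ι → A) × A → (ι → A) × A := fun q => (Function.update q.1 k q.2, q.1 k)
  have hσ : Function.Involutive σ := fun q => by simp [σ]
  have hprod : ∀ (a : ι → A) (c : A),
      (∏ i, p i (Function.update a k c i)) * p k (a k) = (∏ i, p i (a i)) * p k c := by
    intro a c
    rw [← Finset.mul_prod_erase _ _ (Finset.mem_univ k),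
      ← Finset.mul_prod_erase _ (fun i => p i (a i)) (Finset.mem_univ k)]
    have : ∏ i ∈ Finset.univ.erase k, p i (Function.update a k c i)
        = ∏ i ∈ Finset.univ.erase k, p i (a i) :=
      Finset.prod_congr rfl fun i hi => by
        rw [Function.update_of_ne (Finset.ne_of_mem_erase hi)]
    rw [this, Function.update_self]
    ring
  have h1 : prodMean p F = ∑ q : (ι → A) × A, (∏ i, p i (q.1 i)) * p k q.2 * F q.1 := by
    rw [Fintype.sum_prod_type]
    refine Finset.sum_congr rfl fun a _ => ?_
    dsimp only
    rw [← Finset.sum_mul, ← Finset.mul_sum, hk, mul_one]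
  rw [h1, ← Equiv.sum_comp hσ.toPerm, Fintype.sum_prod_type]
  refine Finset.sum_congr rfl fun a _ => ?_
  rw [Finset.mul_sum]
  refine Finset.sum_congr rfl fun c _ => ?_
  simp only [Function.Involutive.coe_toPerm, σ]
  rw [hprod]
  ring

theorem prodMean_mul_of_update (k : ι) (hk : ∑ c, p k c = 1) (u : A → ℝ) {v : (ι → A) → ℝ}
    (hv : ∀ a c, v (Function.update a k c) = v a) :
    prodMean p (fun a => u (a k) * v a) = (∑ c, p k c * u c) * prodMean p v := by
  rw [prodMean_update k hk, ← prodMean_const_mul]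
  congr 1
  ext a
  simp only [hv, Function.update_self, Finset.sum_mul]
  exact Finset.sum_congr rfl fun c _ => by ring

/-- A one-sided form of Stein's identity for sums of independent bounded centred variables. -/
theorem stein_inequality (hp0 : ∀ i a, 0 ≤ p i a) (hp1 : ∀ i, ∑ a, p i a = 1)
    {ξ : ι → A → ℝ} {δ : ℝ} (hδ : ∀ i a, |ξ i a| ≤ δ) (hξ : ∀ i, ∑ a, p i a * ξ i a = 0)
    {f h h' : ℝ → ℝ} (hf : ∀ w s, |s| ≤ δ → s ^ 2 * h w ≤ s * (f (w + s) - f w))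
    (hh : ∀ w s, |s| ≤ δ → h' (w + s) ≤ h w) :
    (∑ i, ∑ a, p i a * ξ i a ^ 2) * prodMean p (fun a => h' (∑ i, ξ i (a i)))
      ≤ prodMean p (fun a => (∑ i, ξ i (a i)) * f (∑ i, ξ i (a i))) := by
  have hinv : ∀ k (a : ι → A) c, (∑ i, ξ i (Function.update a k c i))
      - ξ k (Function.update a k c k) = ∑ i, ξ i (a i) - ξ k (a k) := by
    intro k a c
    rw [← Finset.sum_erase_eq_sub (Finset.mem_univ k),
      ← Finset.sum_erase_eq_sub (f := fun i => ξ i (a i)) (Finset.mem_univ k)]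
    exact Finset.sum_congr rfl fun i hi => by
      rw [Function.update_of_ne (Finset.ne_of_mem_erase hi)]
  rw [Finset.sum_mul]
  have hS : (fun a : ι → A => (∑ i, ξ i (a i)) * f (∑ i, ξ i (a i)))
      = fun a => ∑ k, ξ k (a k) * f (∑ i, ξ i (a i)) := funext fun a => Finset.sum_mul ..
  rw [hS, prodMean_sum]
  refine Finset.sum_le_sum fun k _ => ?_
  have h0 : prodMean p (fun a => ξ k (a k) * f (∑ i, ξ i (a i) - ξ k (a k))) = 0 := by
    rw [prodMean_mul_of_update k (hp1 k) (ξ k) (fun a c => by rw [hinv]), hξ, zero_mul]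
  have h2 : prodMean p (fun a => ξ k (a k) ^ 2 * h (∑ i, ξ i (a i) - ξ k (a k)))
      = (∑ a, p k a * ξ k a ^ 2) * prodMean p (fun a => h (∑ i, ξ i (a i) - ξ k (a k))) :=
    prodMean_mul_of_update k (hp1 k) (fun c => ξ k c ^ 2) (fun a c => by rw [hinv])
  calc (∑ a, p k a * ξ k a ^ 2) * prodMean p (fun a => h' (∑ i, ξ i (a i)))
      ≤ (∑ a, p k a * ξ k a ^ 2) * prodMean p (fun a => h (∑ i, ξ i (a i) - ξ k (a k))) := by
        refine mul_le_mul_of_nonneg_left (prodMean_mono hp0 fun a => ?_)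
          (Finset.sum_nonneg fun a _ => mul_nonneg (hp0 k a) (sq_nonneg _))
        simpa using hh (∑ i, ξ i (a i) - ξ k (a k)) _ (hδ k (a k))
    _ = prodMean p (fun a => ξ k (a k) ^ 2 * h (∑ i, ξ i (a i) - ξ k (a k))) := h2.symm
    _ ≤ prodMean p (fun a => ξ k (a k) * f (∑ i, ξ i (a i))
          + (-1) * (ξ k (a k) * f (∑ i, ξ i (a i) - ξ k (a k)))) := by
        refine prodMean_mono hp0 fun a => ?_
        have := hf (∑ i, ξ i (a i) - ξ k (a k)) _ (hδ k (a k))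
        rw [sub_add_cancel] at this
        linarith
    _ = prodMean p (fun a => ξ k (a k) * f (∑ i, ξ i (a i))) := by
        rw [prodMean_add, prodMean_const_mul, h0]; ring

theorem prodMean_abs_sum_le (hp0 : ∀ i a, 0 ≤ p i a) (hp1 : ∀ i, ∑ a, p i a = 1)
    {ξ : ι → A → ℝ} {δ : ℝ} (hδ : ∀ i a, |ξ i a| ≤ δ) (hξ : ∀ i, ∑ a, p i a * ξ i a = 0)
    {σ : ℝ} (hσ : 0 < σ) (hvar : ∑ i, ∑ a, p i a * ξ i a ^ 2 = σ ^ 2) :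
    prodMean p (fun a => |∑ i, ξ i (a i)|) ≤ σ := by
  have h := stein_inequality hp0 hp1 hδ hξ (f := fun w => -w) (h := fun _ => -1)
    (h' := fun _ => -1) (fun w s _ => by nlinarith) (fun _ _ _ => le_rfl)
  rw [hvar, prodMean_const hp1] at h
  have h3 : prodMean p (fun a => (2 * σ) * |∑ i, ξ i (a i)|) ≤ prodMean p (fun a =>
      σ ^ 2 + (-1) * ((∑ i, ξ i (a i)) * -(∑ i, ξ i (a i)))) := by
    refine prodMean_mono hp0 fun a => ?_
    nlinarith [sq_nonneg (|∑ i, ξ i (a i)| - σ), sq_abs (∑ i, ξ i (a i))]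
  rw [prodMean_const_mul, prodMean_add, prodMean_const_mul, prodMean_const hp1] at h3
  have h4 : (2 * σ) * prodMean p (fun a => |∑ i, ξ i (a i)|) ≤ (2 * σ) * σ := by nlinarith
  exact le_of_mul_le_mul_left h4 (by positivity)

end ProdMean

/-- A lower bound on the right derivative near `w` bounds the increments of `f` from below. -/
theorem sq_mul_le_mul_sub_of_le_deriv_right {f f' : ℝ → ℝ} (hc : Continuous f)
    (hf : ∀ x, HasDerivWithinAt f (f' x) (Set.Ici x) x) {w s m : ℝ}
    (hm : ∀ x, |x - w| ≤ |s| → m ≤ f' x) : s ^ 2 * m ≤ s * (f (w + s) - f w) := by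
  have key : ∀ a b, a ≤ b → (∀ x ∈ Set.Ico a b, m ≤ f' x) → m * (b - a) ≤ f b - f a := by
    intro a b hab h
    have := image_le_of_deriv_right_le_deriv_boundary (f := fun x => f a + m * (x - a))
      (f' := fun _ => m) (B := f) (B' := f') (a := a) (b := b) (by fun_prop)
      (fun x _ => by
        simpa using ((((hasDerivAt_id x).sub_const a).const_mul m).const_add (f a)).hasDerivWithinAt)
      (by simp) hc.continuousOn (fun x _ => hf x) h (Set.right_mem_Icc.2 hab)
    linarith
  rcases le_total 0 s with hs | hs
  · have := key w (w + s) (by linarith) fun x hx => hm x (by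
      rw [abs_of_nonneg (by linarith [hx.1]), abs_of_nonneg hs]; linarith [hx.2])
    nlinarith
  · have := key (w + s) w (by linarith) fun x hx => hm x (by
      rw [abs_of_nonpos (by linarith [hx.2]), abs_of_nonpos hs]; linarith [hx.1])
    nlinarith

theorem exp_neg_abs_le_sigmoid_deriv (x : ℝ) :
    Real.exp (-|x|) / 4 ≤ Real.sigmoid x * (1 - Real.sigmoid x) := by
  rw [← Real.sigmoid_neg, Real.sigmoid_def, Real.sigmoid_def, ← mul_inv, neg_neg, Real.exp_neg,
    div_eq_mul_inv, ← mul_inv]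
  have h1 : Real.exp x ≤ Real.exp |x| := Real.exp_le_exp.2 (le_abs_self x)
  have h2 : Real.exp (-x) ≤ Real.exp |x| := Real.exp_le_exp.2 (neg_le_abs x)
  have h3 : 1 ≤ Real.exp |x| := Real.one_le_exp (abs_nonneg x)
  have h4 : Real.exp (-x) * Real.exp x = 1 := by rw [← Real.exp_add]; simp
  refine inv_anti₀ (by positivity) ?_
  nlinarith

/-- Exponential tilting of a sum of independent bounded centred variables gains a factor of the
inverse standard deviation. -/
theorem prodMean_exp_neg_abs_le {ι A : Type*} [Fintype ι] [DecidableEq ι] [Fintype A]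
    {p : ι → A → ℝ} (hp0 : ∀ i a, 0 ≤ p i a) (hp1 : ∀ i, ∑ a, p i a = 1)
    {ξ : ι → A → ℝ} {δ : ℝ} (hδ : ∀ i a, |ξ i a| ≤ δ) (hξ : ∀ i, ∑ a, p i a * ξ i a = 0)
    {σ : ℝ} (hσ : 0 < σ) (hvar : ∑ i, ∑ a, p i a * ξ i a ^ 2 = σ ^ 2) (t : ℝ) :
    prodMean p (fun a => Real.exp (-|∑ i, ξ i (a i) - t|)) ≤ 4 * Real.exp (2 * δ) / σ := by
  have hder : ∀ x, HasDerivAt (fun w => Real.sigmoid (w - t))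
      (Real.sigmoid (x - t) * (1 - Real.sigmoid (x - t))) x := fun x => by
    simpa using (Real.hasDerivAt_sigmoid (x - t)).comp_sub_const x t
  have h := stein_inequality hp0 hp1 hδ hξ (f := fun w => Real.sigmoid (w - t))
    (h := fun w => Real.exp (-δ) / 4 * Real.exp (-|w - t|))
    (h' := fun w => Real.exp (-(2 * δ)) / 4 * Real.exp (-|w - t|))
    (fun w s hs => by
      refine sq_mul_le_mul_sub_of_le_deriv_right (f := fun w => Real.sigmoid (w - t))
        (f' := fun x => Real.sigmoid (x - t) * (1 - Real.sigmoid (x - t)))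
        (continuous_iff_continuousAt.2 fun x => (hder x).continuousAt)
        (fun x => (hder x).hasDerivWithinAt) fun x hx => ?_
      refine le_trans ?_ (exp_neg_abs_le_sigmoid_deriv (x - t))
      rw [div_mul_eq_mul_div, ← Real.exp_add]
      have : |x - t| ≤ |x - w| + |w - t| := abs_sub_le x w t
      gcongr
      linarith)
    (fun w s hs => by
      rw [div_mul_eq_mul_div, ← Real.exp_add, div_mul_eq_mul_div, ← Real.exp_add]
      have : |w - t| ≤ |w + s - t| + |s| := by
        simpa [add_sub_right_comm] using abs_sub (w + s - t) s
      exact div_le_div_of_nonneg_right (Real.exp_le_exp.2 (by linarith)) (by norm_num))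
  have h2 : prodMean p (fun a => (∑ i, ξ i (a i)) * Real.sigmoid (∑ i, ξ i (a i) - t)) ≤ σ := by
    refine le_trans (prodMean_mono hp0 fun a => ?_) (prodMean_abs_sum_le hp0 hp1 hδ hξ hσ hvar)
    refine le_trans (mul_le_mul_of_nonneg_right (le_abs_self _) (Real.sigmoid_nonneg _)) ?_
    exact mul_le_of_le_one_right (abs_nonneg _) (Real.sigmoid_le_one _)
  rw [hvar, prodMean_const_mul] at h
  have h3 := h.trans h2
  rw [le_div_iff₀ hσ]
  have h4 : Real.exp (2 * δ) * Real.exp (-(2 * δ)) = 1 := by rw [← Real.exp_add]; simp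
  set E := prodMean p (fun a => Real.exp (-|∑ i, ξ i (a i) - t|))
  have h5 : σ * (E * σ * Real.exp (-(2 * δ))) ≤ σ * 4 := by nlinarith
  have h6 := le_of_mul_le_mul_left h5 hσ
  calc E * σ = (E * σ * Real.exp (-(2 * δ))) * Real.exp (2 * δ) := by
        rw [mul_assoc, mul_comm (Real.exp (-(2 * δ))), h4, mul_one]
    _ ≤ 4 * Real.exp (2 * δ) := by gcongr

theorem integrable_exp_neg_sq_div_two : Integrable fun u : ℝ => Real.exp (-u ^ 2 / 2) := by
  convert integrable_exp_neg_mul_sq (b := 1 / 2) (by norm_num) using 3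
  ring

theorem Qfun_nonneg (x : ℝ) : 0 ≤ Qfun x :=
  mul_nonneg (by positivity) (integral_nonneg fun _ => (Real.exp_pos _).le)

theorem Qfun_zero : Qfun 0 = 1 / 2 := by
  have h := integral_gaussian_Ioi (1 / 2)
  have h2 : (fun u : ℝ => Real.exp (-u ^ 2 / 2)) = fun u => Real.exp (-(1 / 2) * u ^ 2) := by
    ext u; congr 1; ring
  rw [Qfun, h2, h, show Real.pi / (1 / 2) = 2 * Real.pi by ring]
  field_simp

theorem Qfun_eq_sub_intervalIntegral (a b : ℝ) :
    Qfun a - Qfun b = (Real.sqrt (2 * Real.pi))⁻¹ * ∫ u in a..b, Real.exp (-u ^ 2 / 2) := by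
  rw [Qfun, Qfun, ← mul_sub, intervalIntegral.integral_Ioi_sub_Ioi'
    integrable_exp_neg_sq_div_two.integrableOn integrable_exp_neg_sq_div_two.integrableOn]

theorem hasDerivAt_Qfun (x : ℝ) :
    HasDerivAt Qfun (-((Real.sqrt (2 * Real.pi))⁻¹ * Real.exp (-x ^ 2 / 2))) x := by
  have h : Qfun = fun y => 1 / 2 - (Real.sqrt (2 * Real.pi))⁻¹ *
      ∫ u in (0 : ℝ)..y, Real.exp (-u ^ 2 / 2) := by
    ext y
    rw [← Qfun_eq_sub_intervalIntegral, Qfun_zero]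
    ring
  rw [h]
  have hc : Continuous fun u : ℝ => Real.exp (-u ^ 2 / 2) := by fun_prop
  exact ((hc.integral_hasStrictDerivAt 0 x).hasDerivAt.const_mul _).const_sub _

theorem continuous_Qfun : Continuous Qfun :=
  continuous_iff_continuousAt.2 fun x => (hasDerivAt_Qfun x).continuousAt

theorem Qfun_neg (x : ℝ) : Qfun (-x) = 1 - Qfun x := by
  have h1 := Qfun_eq_sub_intervalIntegral 0 x
  have h2 := Qfun_eq_sub_intervalIntegral (-x) 0
  have h3 := intervalIntegral.integral_comp_neg (a := 0) (b := x)
    (fun u : ℝ => Real.exp (-u ^ 2 / 2))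
  simp only [neg_sq, neg_zero] at h3
  rw [h3] at h1
  rw [Qfun_zero] at h1 h2
  linarith

theorem Qfun_antitone : Antitone Qfun :=
  antitone_of_hasDerivAt_nonpos hasDerivAt_Qfun fun _ => neg_nonpos.2 (by positivity)

theorem mul_Qfun_le {x : ℝ} :
    x * Qfun x ≤ (Real.sqrt (2 * Real.pi))⁻¹ * Real.exp (-x ^ 2 / 2) := by
  have hintegrable : Integrable fun u : ℝ => u * Real.exp (-u ^ 2 / 2) := by
    convert integrable_mul_exp_neg_mul_sq (b := 1 / 2) (by norm_num) using 4
    ring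
  have hval : ∫ u in Set.Ioi x, u * Real.exp (-u ^ 2 / 2) = 0 - -Real.exp (-x ^ 2 / 2) := by
    refine integral_Ioi_of_hasDerivAt_of_tendsto' (f := fun u => -Real.exp (-u ^ 2 / 2))
      (fun u _ => ?_) hintegrable.integrableOn ?_
    · have h : HasDerivAt (fun u : ℝ => -u ^ 2 / 2) (-u) u := by
        refine ((hasDerivAt_pow 2 u).fun_neg.div_const 2).congr_deriv ?_
        simp; ring
      refine h.exp.fun_neg.congr_deriv ?_
      ring
    · rw [← neg_zero]
      refine (Real.tendsto_exp_atBot.comp ?_).neg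
      have : Filter.Tendsto (fun u : ℝ => u ^ 2 / 2) Filter.atTop Filter.atTop :=
        (Filter.tendsto_pow_atTop two_ne_zero).atTop_div_const (by norm_num)
      refine (Filter.tendsto_neg_atTop_atBot.comp this).congr fun u => ?_
      simp [neg_div]
  have : x * ∫ u in Set.Ioi x, Real.exp (-u ^ 2 / 2) ≤ Real.exp (-x ^ 2 / 2) := by
    rw [← integral_const_mul]
    calc _ ≤ ∫ u in Set.Ioi x, u * Real.exp (-u ^ 2 / 2) := by
          refine setIntegral_mono_on (integrable_exp_neg_sq_div_two.integrableOn.const_mul x)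
            hintegrable.integrableOn measurableSet_Ioi fun u hu => ?_
          exact mul_le_mul_of_nonneg_right (le_of_lt hu) (Real.exp_pos _).le
      _ = _ := by rw [hval]; ring
  rw [Qfun, mul_left_comm]
  gcongr

/-- The Mills ratio of the standard Gaussian. -/
def millsRatio (x : ℝ) : ℝ := Real.sqrt (2 * Real.pi) * Real.exp (x ^ 2 / 2) * Qfun x

theorem millsRatio_nonneg (x : ℝ) : 0 ≤ millsRatio x :=
  mul_nonneg (by positivity) (Qfun_nonneg x)

theorem mul_millsRatio_le (x : ℝ) : x * millsRatio x ≤ 1 := by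
  have h := mul_le_mul_of_nonneg_left (mul_Qfun_le (x := x))
    (show 0 ≤ Real.sqrt (2 * Real.pi) * Real.exp (x ^ 2 / 2) by positivity)
  have h2 : Real.exp (x ^ 2 / 2) * Real.exp (-x ^ 2 / 2) = 1 := by
    rw [← Real.exp_add, ← Real.exp_zero]; congr 1; ring
  have h3 : Real.sqrt (2 * Real.pi) * (Real.sqrt (2 * Real.pi))⁻¹ = 1 :=
    mul_inv_cancel₀ (by positivity)
  calc x * millsRatio x = _ := by rw [millsRatio]; ring
    _ ≤ _ := h
    _ = (Real.sqrt (2 * Real.pi) * (Real.sqrt (2 * Real.pi))⁻¹) *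
        (Real.exp (x ^ 2 / 2) * Real.exp (-x ^ 2 / 2)) := by ring
    _ = 1 := by rw [h2, h3, one_mul]

theorem hasDerivAt_millsRatio (x : ℝ) : HasDerivAt millsRatio (x * millsRatio x - 1) x := by
  have h2 : Real.exp (x ^ 2 / 2) * Real.exp (-x ^ 2 / 2) = 1 := by
    rw [← Real.exp_add, ← Real.exp_zero]; congr 1; ring
  have h3 : Real.sqrt (2 * Real.pi) * (Real.sqrt (2 * Real.pi))⁻¹ = 1 :=
    mul_inv_cancel₀ (by positivity)
  have h := ((((hasDerivAt_pow 2 x).div_const 2).exp).const_mul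
    (Real.sqrt (2 * Real.pi))).mul (hasDerivAt_Qfun x)
  refine h.congr_deriv ?_
  simp only [millsRatio]
  push_cast
  linear_combination (-1 : ℝ) * h3 * (Real.exp (x ^ 2 / 2) * Real.exp (-x ^ 2 / 2)) - h2

theorem millsRatio_antitone : Antitone millsRatio :=
  antitone_of_hasDerivAt_nonpos hasDerivAt_millsRatio fun x => by
    simp only [Pi.zero_apply]; linarith [mul_millsRatio_le x]

theorem millsRatio_le_two {x : ℝ} (hx : 0 ≤ x) : millsRatio x ≤ 2 := by
  refine (millsRatio_antitone hx).trans ?_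
  have : Real.sqrt (2 * Real.pi) ≤ 4 := by
    rw [Real.sqrt_le_left (by norm_num)]; nlinarith [Real.pi_lt_four]
  rw [millsRatio, Qfun_zero]
  simp only [ne_eq, OfNat.ofNat_ne_zero, not_false_eq_true, zero_pow, zero_div, Real.exp_zero]
  linarith

theorem Qfun_neg_mul_millsRatio (x : ℝ) : Qfun (-x) * millsRatio x = Qfun x * millsRatio (-x) := by
  simp only [millsRatio, neg_sq]; ring

/-- The solution of Stein's equation for the indicator of the half-line `[x, ∞)`. -/
def steinSolution (x w : ℝ) : ℝ :=
  if x ≤ w then -(Qfun (-x) * millsRatio w) else -(Qfun x * millsRatio (-w))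

theorem continuous_millsRatio : Continuous millsRatio :=
  continuous_iff_continuousAt.2 fun x => (hasDerivAt_millsRatio x).continuousAt

theorem continuous_steinSolution (x : ℝ) : Continuous (steinSolution x) := by
  refine Continuous.if_le ?_ ?_ continuous_const continuous_id ?_
  · exact (continuous_const.mul continuous_millsRatio).neg
  · exact (continuous_const.mul (continuous_millsRatio.comp continuous_neg)).neg
  · rintro w rfl
    rw [Qfun_neg_mul_millsRatio]

theorem hasDerivWithinAt_steinSolution (x w : ℝ) :
    HasDerivWithinAt (steinSolution x)
      (w * steinSolution x w + (if x ≤ w then 1 else 0) - Qfun x) (Set.Ici w) w := by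
  by_cases h : x ≤ w
  · have h1 : HasDerivAt (fun w => -(Qfun (-x) * millsRatio w))
        (w * steinSolution x w + (if x ≤ w then 1 else 0) - Qfun x) w := by
      refine (((hasDerivAt_millsRatio w).const_mul _).fun_neg).congr_deriv ?_
      rw [steinSolution, if_pos h, if_pos h, Qfun_neg]
      ring
    refine h1.hasDerivWithinAt.congr (fun y hy => ?_) ?_
    · rw [steinSolution, if_pos (h.trans hy)]
    · rw [steinSolution, if_pos h]
  · have h1 : HasDerivAt (fun w => -(Qfun x * millsRatio (-w)))
        (w * steinSolution x w + (if x ≤ w then 1 else 0) - Qfun x) w := by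
      refine ((((hasDerivAt_millsRatio (-w)).comp w (hasDerivAt_neg w)).const_mul
        (Qfun x)).fun_neg).congr_deriv ?_
      rw [steinSolution, if_neg h, if_neg h]
      ring
    refine HasDerivAt.hasDerivWithinAt (h1.congr_of_eventuallyEq ?_)
    filter_upwards [Iio_mem_nhds (not_le.1 h)] with y hy
    rw [steinSolution, if_neg (not_le.2 hy)]

theorem abs_Qfun_mul_millsRatio_le {x w : ℝ} (h : x ≤ w) :
    |Qfun (-x) * millsRatio w| ≤ 2 ∧ |w * (Qfun (-x) * millsRatio w)| ≤ 1 := by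
  have hQ : ∀ y, Qfun y ≤ 1 := fun y => by linarith [Qfun_neg y, Qfun_nonneg (-y)]
  have key : ∃ q v, 0 ≤ v ∧ |w| = v ∧ 0 ≤ q ∧ q ≤ 1 ∧
      Qfun (-x) * millsRatio w ≤ q * millsRatio v := by
    rcases le_total 0 w with hw | hw
    · exact ⟨_, w, hw, abs_of_nonneg hw, Qfun_nonneg _, hQ _, le_rfl⟩
    · refine ⟨Qfun w, -w, by linarith, abs_of_nonpos hw, Qfun_nonneg _, hQ _, ?_⟩
      rw [← Qfun_neg_mul_millsRatio]
      exact mul_le_mul_of_nonneg_right (Qfun_antitone (neg_le_neg h)) (millsRatio_nonneg _)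
  obtain ⟨q, v, hv, hwv, hq0, hq1, hle⟩ := key
  have h0 := mul_nonneg (Qfun_nonneg (-x)) (millsRatio_nonneg w)
  have hm := millsRatio_nonneg v
  rw [abs_mul w, hwv, abs_of_nonneg h0]
  constructor
  · nlinarith [millsRatio_le_two hv]
  · nlinarith [mul_millsRatio_le v, mul_nonneg hv hm]

theorem abs_steinSolution_le (x w : ℝ) :
    |steinSolution x w| ≤ 2 ∧ |w * steinSolution x w| ≤ 1 := by
  rw [steinSolution]
  split_ifs with h
  · simpa only [mul_neg, abs_neg] using abs_Qfun_mul_millsRatio_le h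
  · have := abs_Qfun_mul_millsRatio_le (neg_le_neg (not_le.1 h).le)
    simpa only [mul_neg, abs_neg, neg_neg, neg_mul] using this

theorem abs_steinSolution_sub_le (x a b : ℝ) :
    |steinSolution x b - steinSolution x a| ≤ 2 * |b - a| := by
  have key : ∀ a b, a ≤ b → |steinSolution x b - steinSolution x a| ≤ 2 * (b - a) := by
    intro a b hab
    refine norm_image_sub_le_of_norm_deriv_right_le_segment
      (continuous_steinSolution x).continuousOn
      (fun w _ => hasDerivWithinAt_steinSolution x w) (fun w _ => ?_) b (Set.right_mem_Icc.2 hab)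
    have h1 := abs_le.1 (abs_steinSolution_le x w).2
    have h2 := Qfun_nonneg x
    have h3 := Qfun_nonneg (-x)
    rw [Qfun_neg] at h3
    rw [Real.norm_eq_abs, abs_le]
    split_ifs <;> constructor <;> linarith
  rcases le_total a b with h | h
  · rw [abs_of_nonneg (sub_nonneg.2 h)]; exact key a b h
  · rw [abs_sub_comm, abs_of_nonpos (sub_nonpos.2 h), neg_sub]; exact key b a h

theorem abs_mul_steinSolution_sub_le (x a b : ℝ) :
    |b * steinSolution x b - a * steinSolution x a| ≤ (2 * |a| + 2) * |b - a| := by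
  calc _ = |a * (steinSolution x b - steinSolution x a) + (b - a) * steinSolution x b| := by
        congr 1; ring
    _ ≤ |a| * |steinSolution x b - steinSolution x a| + |b - a| * |steinSolution x b| := by
        rw [← abs_mul, ← abs_mul]; exact abs_add_le _ _
    _ ≤ |a| * (2 * |b - a|) + |b - a| * 2 := by
        gcongr
        · exact abs_steinSolution_sub_le x a b
        · exact (abs_steinSolution_le x b).1
    _ = _ := by ring

/-- A one-sided Berry–Esseen bound for sums of independent bounded centred variables with total
variance one. -/
theorem prodMean_indicator_le_Qfun {ι A : Type*} [Fintype ι] [DecidableEq ι] [Fintype A]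
    {p : ι → A → ℝ} (hp0 : ∀ i a, 0 ≤ p i a) (hp1 : ∀ i, ∑ a, p i a = 1)
    {ξ : ι → A → ℝ} {δ : ℝ} (hδ0 : 0 ≤ δ) (hδ : ∀ i a, |ξ i a| ≤ δ)
    (hξ : ∀ i, ∑ a, p i a * ξ i a = 0) (hvar : ∑ i, ∑ a, p i a * ξ i a ^ 2 = 1) (x : ℝ) :
    prodMean p (fun a => if x + 2 * δ ≤ ∑ i, ξ i (a i) then 1 else 0)
      ≤ Qfun x + 8 * δ + 4 * δ ^ 2 := by
  have h := stein_inequality hp0 hp1 hδ hξ (f := steinSolution x)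
    (h := fun w => w * steinSolution x w - (2 * |w| + 2) * δ
      + (if x + δ ≤ w then 1 else 0) - Qfun x)
    (h' := fun w => w * steinSolution x w + (if x + 2 * δ ≤ w then 1 else 0)
      + (-(4 * δ)) * |w| + -(Qfun x + 4 * δ + 4 * δ ^ 2))
    (fun w s hs => by
      refine sq_mul_le_mul_sub_of_le_deriv_right (continuous_steinSolution x)
        (hasDerivWithinAt_steinSolution x) fun y hy => ?_
      have h1 := (abs_le.1 (abs_mul_steinSolution_sub_le x w y)).1
      have h2 : (2 * |w| + 2) * |y - w| ≤ (2 * |w| + 2) * δ :=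
        mul_le_mul_of_nonneg_left (hy.trans hs) (by positivity)
      have h3 : (if x + δ ≤ w then (1 : ℝ) else 0) ≤ if x ≤ y then 1 else 0 := by
        have := (abs_le.1 (hy.trans hs)).1
        split_ifs <;> first | (exfalso; linarith) | norm_num
      linarith)
    (fun w s hs => by
      have h1 := (abs_le.1 (abs_mul_steinSolution_sub_le x w (w + s))).2
      rw [add_sub_cancel_left] at h1
      have h2 : (2 * |w| + 2) * |s| ≤ (2 * |w| + 2) * δ :=
        mul_le_mul_of_nonneg_left hs (by positivity)
      have h3 : (if x + 2 * δ ≤ w + s then (1 : ℝ) else 0) ≤ if x + δ ≤ w then 1 else 0 := by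
        have := (abs_le.1 hs).2
        split_ifs <;> first | (exfalso; linarith) | norm_num
      have h4 : |w| ≤ |w + s| + δ := by
        have : |w| ≤ |w + s| + |s| := by simpa using abs_sub (w + s) s
        linarith
      nlinarith)
  have hE : prodMean p (fun a => |∑ i, ξ i (a i)|) ≤ 1 :=
    prodMean_abs_sum_le hp0 hp1 hδ hξ one_pos (by rw [hvar, one_pow])
  rw [hvar, one_mul, prodMean_add, prodMean_add, prodMean_add, prodMean_const hp1,
    prodMean_const_mul] at h
  nlinarith

theorem prodMean_eval {ι A : Type*} [Fintype ι] [DecidableEq ι] [Fintype A] {p : A → ℝ}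
    (hp1 : ∑ a, p a = 1) (j : ι) (H : A → ℝ) :
    prodMean (fun _ : ι => p) (fun f => H (f j)) = ∑ a, p a * H a := by
  rw [prodMean_update j hp1]
  simp only [Function.update_self]
  exact prodMean_const (fun _ => hp1) _

theorem prodMean_eval₂ {ι A : Type*} [Fintype ι] [DecidableEq ι] [Fintype A] {p : A → ℝ}
    (hp1 : ∑ a, p a = 1) {j k : ι} (hjk : j ≠ k) (H : A → A → ℝ) :
    prodMean (fun _ : ι => p) (fun f => H (f j) (f k)) = ∑ a, p a * ∑ a', p a' * H a a' := by
  rw [prodMean_update k hp1]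
  simp only [Function.update_self, Function.update_of_ne hjk]
  exact prodMean_eval hp1 j fun a => ∑ a', p a' * H a a'

theorem exists_le_of_prodMean_le {ι A : Type*} [Fintype ι] [DecidableEq ι] [Fintype A]
    {p : ι → A → ℝ} (hp0 : ∀ i a, 0 ≤ p i a) (hp1 : ∀ i, ∑ a, p i a = 1)
    {F : (ι → A) → ℝ} {c : ℝ} (h : prodMean p F ≤ c) : ∃ a, F a ≤ c := by
  by_contra! hF
  have hw : ∀ a : ι → A, 0 ≤ ∏ i, p i (a i) := fun a => Finset.prod_nonneg fun i _ => hp0 i (a i)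
  obtain ⟨a, ha⟩ : ∃ a : ι → A, 0 < ∏ i, p i (a i) := by
    by_contra! h0
    have h1 := prodMean_one hp1
    simp only [prodMean, mul_one] at h1
    linarith [Finset.sum_nonpos fun (a : ι → A) (_ : a ∈ Finset.univ) => h0 a]
  have : prodMean p (fun _ => c) < prodMean p F :=
    Finset.sum_lt_sum (fun a _ => mul_le_mul_of_nonneg_left (hF a).le (hw a))
      ⟨a, Finset.mem_univ a, mul_lt_mul_of_pos_left (hF a) ha⟩
  rw [prodMean_const hp1] at this
  linarith

/-- Random coding with maximum-likelihood decoding: some code is as good as the union bound, where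
the pairs in `bad` are written off as errors. -/
theorem exists_code_le {A B : Type*} [Fintype A] [Fintype B] {p : A → ℝ} {w : A → B → ℝ}
    (hp0 : ∀ a, 0 ≤ p a) (hp1 : ∑ a, p a = 1) (hw0 : ∀ a b, 0 ≤ w a b)
    {M : ℕ} (hM : 1 ≤ M) (bad : A → B → Prop) :
    ∃ (f : Fin M → A) (g : B → Fin M),
      (M : ℝ)⁻¹ * ∑ j, ∑ b, w (f j) b * (if g b = j then 0 else 1)
        ≤ ∑ a, p a * ∑ b, w a b * (if bad a b then 1 else 0)
          + ((M : ℝ) - 1) * ∑ a, p a * ∑ a', p a' *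
              ∑ b, w a b * (if ¬ bad a b ∧ w a b ≤ w a' b then 1 else 0) := by
  have hdec : ∀ f : Fin M → A, ∃ g : B → Fin M, ∀ b j,
      (∀ k ≠ j, w (f k) b < w (f j) b) → g b = j := by
    intro f
    refine ⟨fun b => if h : ∃ j, ∀ k ≠ j, w (f k) b < w (f j) b then h.choose else ⟨0, hM⟩,
      fun b j hj => ?_⟩
    have h : ∃ j, ∀ k ≠ j, w (f k) b < w (f j) b := ⟨j, hj⟩
    simp only [dif_pos h]
    by_contra hne
    exact lt_asymm (h.choose_spec j (Ne.symm hne)) (hj _ hne)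
  choose g hg using hdec
  let H₁ : A → ℝ := fun a => ∑ b, w a b * (if bad a b then 1 else 0)
  let H₂ : A → A → ℝ := fun a a' =>
    ∑ b, w a b * (if ¬ bad a b ∧ w a b ≤ w a' b then 1 else 0)
  have herr : ∀ f j, ∑ b, w (f j) b * (if g f b = j then 0 else 1)
      ≤ H₁ (f j) + ∑ k ∈ Finset.univ.erase j, H₂ (f j) (f k) := by
    intro f j
    simp only [H₁, H₂]
    rw [Finset.sum_comm, ← Finset.sum_add_distrib]
    refine Finset.sum_le_sum fun b _ => ?_
    rw [← Finset.mul_sum, ← mul_add]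
    refine mul_le_mul_of_nonneg_left ?_ (hw0 _ _)
    have hnn : ∀ k ∈ Finset.univ.erase j,
        (0 : ℝ) ≤ if ¬ bad (f j) b ∧ w (f j) b ≤ w (f k) b then 1 else 0 :=
      fun k _ => by split_ifs <;> norm_num
    by_cases hgb : g f b = j
    · rw [if_pos hgb]
      exact add_nonneg (by split_ifs <;> norm_num) (Finset.sum_nonneg hnn)
    · rw [if_neg hgb]
      by_cases hbad : bad (f j) b
      · rw [if_pos hbad]
        exact le_add_of_nonneg_right (Finset.sum_nonneg hnn)
      · obtain ⟨k, hk, hle⟩ : ∃ k ≠ j, w (f j) b ≤ w (f k) b := by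
          by_contra! h
          exact hgb (hg f b j h)
        have := Finset.single_le_sum hnn (Finset.mem_erase.2 ⟨hk, Finset.mem_univ k⟩)
        rw [if_pos ⟨hbad, hle⟩] at this
        rw [if_neg hbad, zero_add]
        exact this
  have hM0 : (0 : ℝ) < M := by exact_mod_cast hM
  have hmean : prodMean (fun _ : Fin M => p) (fun f =>
      (M : ℝ)⁻¹ * ∑ j, ∑ b, w (f j) b * (if g f b = j then 0 else 1))
      ≤ ∑ a, p a * H₁ a + ((M : ℝ) - 1) * ∑ a, p a * ∑ a', p a' * H₂ a a' := by
    rw [prodMean_const_mul, inv_mul_le_iff₀ hM0]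
    refine (prodMean_mono (fun _ => hp0) fun f => Finset.sum_le_sum fun j _ => herr f j).trans ?_
    rw [prodMean_sum]
    refine le_of_eq ?_
    have hj : ∀ j : Fin M, prodMean (fun _ : Fin M => p)
        (fun f => H₁ (f j) + ∑ k ∈ Finset.univ.erase j, H₂ (f j) (f k))
        = ∑ a, p a * H₁ a + ((M : ℝ) - 1) * ∑ a, p a * ∑ a', p a' * H₂ a a' := by
      intro j
      rw [prodMean_add, prodMean_eval hp1, prodMean_sum,
        Finset.sum_congr rfl fun k hk =>
          prodMean_eval₂ hp1 (Finset.ne_of_mem_erase hk).symm H₂]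
      rw [Finset.sum_const, Finset.card_erase_of_mem (Finset.mem_univ j), Finset.card_univ,
        Fintype.card_fin, nsmul_eq_mul, Nat.cast_sub hM, Nat.cast_one]
    rw [Finset.sum_congr rfl fun j _ => hj j, Finset.sum_const, Finset.card_univ,
      Fintype.card_fin, nsmul_eq_mul]
  obtain ⟨f, hf⟩ := exists_le_of_prodMean_le (fun _ => hp0) (fun _ => hp1) hmean
  exact ⟨f, g f, hf⟩

theorem exists_Qfun_add_le (q : ℝ) :
    ∃ φ : ℝ, 0 < φ ∧ ∀ h : ℝ, 0 < h → h ≤ 1 → Qfun (q + h) ≤ Qfun q - φ * h := by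
  refine ⟨(Real.sqrt (2 * Real.pi))⁻¹ * Real.exp (-(|q| + 1) ^ 2 / 2), by positivity,
    fun h h0 h1 => ?_⟩
  have key := sq_mul_le_mul_sub_of_le_deriv_right (f := fun x => -Qfun x)
    (f' := fun x => (Real.sqrt (2 * Real.pi))⁻¹ * Real.exp (-x ^ 2 / 2)) (w := q) (s := h)
    (m := (Real.sqrt (2 * Real.pi))⁻¹ * Real.exp (-(|q| + 1) ^ 2 / 2)) continuous_Qfun.neg
    (fun x => ((hasDerivAt_Qfun x).fun_neg.congr_deriv (neg_neg _)).hasDerivWithinAt)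
    (fun x hx => by
      have h2 : |x| ≤ |q| + 1 := by
        have := abs_add_le (x - q) q
        rw [sub_add_cancel] at this
        rw [abs_of_pos h0] at hx
        linarith
      have h3 : x ^ 2 ≤ (|q| + 1) ^ 2 := by
        rw [← sq_abs x]
        gcongr
      gcongr)
  rw [sq, mul_assoc] at key
  have := le_of_mul_le_mul_left key h0
  linarith

theorem sum_prod_mul_eq_prodMean {X Y ι : Type*} [Fintype X] [Fintype Y] [Fintype ι]
    [DecidableEq ι] (P : X → ℝ)
    (W : X → Y → ℝ) (F : (ι → X) → (ι → Y) → ℝ) :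
    ∑ x : ι → X, (∏ t, P (x t)) * ∑ y : ι → Y, (∏ t, W (x t) (y t)) * F x y
      = prodMean (fun (_ : ι) (z : X × Y) => P z.1 * W z.1 z.2)
          (fun z => F (fun t => (z t).1) (fun t => (z t).2)) := by
  rw [prodMean, ← (Equiv.arrowProdEquivProdArrow ι (fun _ => X) (fun _ => Y)).symm.sum_comp,
    Fintype.sum_prod_type]
  refine Finset.sum_congr rfl fun x _ => ?_
  rw [Finset.mul_sum]
  refine Finset.sum_congr rfl fun y _ => ?_
  simp only [Equiv.arrowProdEquivProdArrow, Equiv.coe_fn_symm_mk, Finset.prod_mul_distrib]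
  ring

/-- Change of measure from the input distribution to the backward channel. -/
theorem sum_prod_indicator_le {X Y ι : Type*} [Fintype X] [Fintype ι] [DecidableEq ι] {P : X → ℝ}
    {W : X → Y → ℝ} {PY : Y → ℝ} (hP0 : ∀ x, 0 ≤ P x) (hW0 : ∀ x y, 0 ≤ W x y)
    {x : ι → X} {y : ι → Y} (hx : ∀ t, 0 < W (x t) (y t)) (hy : ∀ t, 0 < PY (y t)) :
    ∑ x' : ι → X, (∏ t, P (x' t)) *
        (if ∏ t, W (x t) (y t) ≤ ∏ t, W (x' t) (y t) then 1 else 0)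
      ≤ Real.exp (-∑ t, Real.log (W (x t) (y t) / PY (y t))) *
        prodMean (fun t a => P a * W a (y t) / PY (y t)) (fun x' => Real.exp
          (-|∑ t, Real.log (W (x' t) (y t) / PY (y t))
            - ∑ t, Real.log (W (x t) (y t) / PY (y t))|)) := by
  have hexp : ∀ u : ι → X, (∀ t, 0 < W (u t) (y t)) →
      Real.exp (∑ t, Real.log (W (u t) (y t) / PY (y t)))
        = (∏ t, W (u t) (y t)) / ∏ t, PY (y t) := by
    intro u hu
    rw [Real.exp_sum, ← Finset.prod_div_distrib]
    exact Finset.prod_congr rfl fun t _ => Real.exp_log (div_pos (hu t) (hy t))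
  have hYpos : 0 < ∏ t, PY (y t) := Finset.prod_pos fun t _ => hy t
  rw [← prodMean_const_mul]
  refine Finset.sum_le_sum fun x' _ => ?_
  split_ifs with h
  · have hpos : 0 < ∏ t, W (x' t) (y t) := (Finset.prod_pos fun t _ => hx t).trans_le h
    have hx' : ∀ t, 0 < W (x' t) (y t) := fun t =>
      (hW0 _ _).lt_of_ne' (Finset.prod_ne_zero_iff.1 hpos.ne' t (Finset.mem_univ t))
    have hle : ∑ t, Real.log (W (x t) (y t) / PY (y t))
        ≤ ∑ t, Real.log (W (x' t) (y t) / PY (y t)) := by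
      rw [← Real.exp_le_exp, hexp x hx, hexp x' hx']
      gcongr
    dsimp only
    rw [abs_of_nonneg (sub_nonneg.2 hle), ← Real.exp_add, neg_sub, neg_add_eq_sub,
      sub_sub_cancel_left, Real.exp_neg, hexp x' hx', Finset.prod_div_distrib,
      Finset.prod_mul_distrib]
    refine le_of_eq ?_
    field_simp
  · rw [mul_zero]
    exact mul_nonneg (Finset.prod_nonneg fun t _ =>
      div_nonneg (mul_nonneg (hP0 _) (hW0 _ _)) (hy t).le) (by positivity)

/-- The probability that an independent codeword beats the transmitted one decays like the
exponential of the information density, with an extra factor of `1 / √n`. -/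
theorem exists_sum_prod_indicator_le {X Y : Type*} [Fintype X] [Fintype Y]
    {P : X → ℝ} {W : X → Y → ℝ} {PY : Y → ℝ}
    (hP0 : ∀ x, 0 ≤ P x) (hW0 : ∀ x y, 0 ≤ W x y) (hPY : ∀ y, PY y = ∑ x, P x * W x y)
    (hcondV : ∀ y, 0 < PY y → 0 < ∑ x, (P x * W x y / PY y) *
      (Real.log (W x y / PY y)
        - ∑ x', (P x' * W x' y / PY y) * Real.log (W x' y / PY y)) ^ 2) :
    ∃ K : ℝ, 0 ≤ K ∧ ∀ n : ℕ, 1 ≤ n → ∀ (x : Fin n → X) (y : Fin n → Y),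
      (∀ t, 0 < W (x t) (y t)) → (∀ t, 0 < PY (y t)) →
      ∑ x' : Fin n → X, (∏ t, P (x' t)) *
          (if ∏ t, W (x t) (y t) ≤ ∏ t, W (x' t) (y t) then 1 else 0)
        ≤ K / Real.sqrt n * Real.exp (-∑ t, Real.log (W (x t) (y t) / PY (y t))) := by
  set μ : Y → ℝ := fun y => ∑ x', (P x' * W x' y / PY y) * Real.log (W x' y / PY y) with hμ
  set v : Y → ℝ := fun y => ∑ x, (P x * W x y / PY y) * (Real.log (W x y / PY y) - μ y) ^ 2
    with hv
  obtain ⟨v₀, hv₀, hv₀le⟩ : ∃ v₀ : ℝ, 0 < v₀ ∧ ∀ y, 0 < PY y → v₀ ≤ v y := by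
    rcases (Finset.univ.filter fun y => 0 < PY y).eq_empty_or_nonempty with he | hne
    · exact ⟨1, one_pos, fun y hy =>
        (Finset.filter_eq_empty_iff.1 he (Finset.mem_univ y) hy).elim⟩
    · obtain ⟨y₀, hy₀, hmin⟩ := Finset.exists_min_image _ v hne
      exact ⟨v y₀, hcondV y₀ (Finset.mem_filter.1 hy₀).2, fun y hy =>
        hmin y (Finset.mem_filter.2 ⟨Finset.mem_univ y, hy⟩)⟩
  obtain ⟨δ, hδ⟩ := (Set.finite_range
    (fun z : X × Y => |Real.log (W z.1 z.2 / PY z.2) - μ z.2|)).bddAbove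
  refine ⟨4 * Real.exp (2 * δ) / Real.sqrt v₀, by positivity, fun n hn x y hx hy => ?_⟩
  have hn0 : (0 : ℝ) < n := by exact_mod_cast hn
  have hr0 : ∀ (t : Fin n) a, 0 ≤ P a * W a (y t) / PY (y t) := fun t a =>
    div_nonneg (mul_nonneg (hP0 _) (hW0 _ _)) (hy t).le
  have hr1 : ∀ t : Fin n, ∑ a, P a * W a (y t) / PY (y t) = 1 := fun t => by
    rw [← Finset.sum_div, ← hPY, div_self (hy t).ne']
  have hsum : n * v₀ ≤ ∑ t, v (y t) := by
    have := Finset.card_nsmul_le_sum Finset.univ (fun t => v (y t)) v₀ fun t _ =>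
      hv₀le (y t) (hy t)
    simpa using this
  have hsumpos : 0 < ∑ t, v (y t) := lt_of_lt_of_le (by positivity) hsum
  have hbound := prodMean_exp_neg_abs_le hr0 hr1
    (ξ := fun t a => Real.log (W a (y t) / PY (y t)) - μ (y t)) (δ := δ)
    (fun t a => hδ ⟨(a, y t), rfl⟩)
    (fun t => by
      simp only [mul_sub, Finset.sum_sub_distrib, ← Finset.sum_mul, hr1, one_mul]
      exact sub_self _)
    (Real.sqrt_pos.2 hsumpos) (Real.sq_sqrt hsumpos.le).symm
    (∑ t, Real.log (W (x t) (y t) / PY (y t)) - ∑ t, μ (y t))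
  simp only [Finset.sum_sub_distrib, sub_sub_sub_cancel_right] at hbound
  refine (sum_prod_indicator_le hP0 hW0 hx hy).trans ?_
  rw [mul_comm]
  refine mul_le_mul_of_nonneg_right (hbound.trans ?_) (Real.exp_pos _).le
  rw [div_div, ← Real.sqrt_mul hv₀.le, mul_comm v₀]
  gcongr

/-- The Berry–Esseen bound `prodMean_indicator_le_Qfun` for independent copies of one variable. -/
theorem prodMean_iid_indicator_le_Qfun {A : Type*} [Fintype A] {p η : A → ℝ} {B V : ℝ}
    (hp0 : ∀ z, 0 ≤ p z) (hp1 : ∑ z, p z = 1) (hB0 : 0 ≤ B) (hηB : ∀ z, |η z| ≤ B)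
    (hmean : ∑ z, p z * η z = 0) (hvar : ∑ z, p z * η z ^ 2 = V) (hV : 0 < V)
    {n : ℕ} (hn : 1 ≤ n) (x : ℝ) :
    prodMean (fun _ : Fin n => p) (fun z => if ∑ t, η (z t)
        ≤ -(Real.sqrt n * Real.sqrt V * (x + 2 * (B / Real.sqrt V / Real.sqrt n))) then 1 else 0)
      ≤ Qfun x + 8 * (B / Real.sqrt V / Real.sqrt n)
        + 4 * (B / Real.sqrt V / Real.sqrt n) ^ 2 := by
  have hn0 : (0 : ℝ) < n := by exact_mod_cast hn
  have hs : 0 < Real.sqrt n * Real.sqrt V := by positivity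
  refine le_trans (prodMean_mono (fun _ => hp0) fun z => ?_)
    (prodMean_indicator_le_Qfun (p := fun _ : Fin n => p)
      (ξ := fun _ z => -η z / (Real.sqrt n * Real.sqrt V)) (δ := B / Real.sqrt V / Real.sqrt n)
      (fun _ => hp0) (fun _ => hp1) (by positivity) (fun _ z => ?_) (fun _ => ?_) ?_ x)
  · refine le_of_eq (if_congr ?_ rfl rfl)
    rw [← Finset.sum_div, le_div_iff₀ hs, Finset.sum_neg_distrib, le_neg, mul_comm]
  · rw [abs_div, abs_neg, abs_of_pos hs, div_div, mul_comm (Real.sqrt n)]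
    gcongr
    exact hηB z
  · simp only [mul_div_assoc', mul_neg, ← Finset.sum_div, Finset.sum_neg_distrib, hmean]
    simp
  · simp only [div_pow, neg_sq, mul_div_assoc', ← Finset.sum_div, hvar]
    rw [Finset.sum_const, Finset.card_univ, Fintype.card_fin, nsmul_eq_mul, mul_pow,
      Real.sq_sqrt hn0.le, Real.sq_sqrt hV.le]
    field_simp

/-- The average of the union bound in `exists_code_le` for a memoryless channel. -/
theorem exists_union_bound_le {X Y : Type*} [Fintype X] [Fintype Y]
    {P : X → ℝ} {W : X → Y → ℝ} {PY : Y → ℝ}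
    (hP0 : ∀ x, 0 ≤ P x) (hP1 : ∑ x, P x = 1) (hW0 : ∀ x y, 0 ≤ W x y)
    (hW1 : ∀ x, ∑ y, W x y = 1) (hPY : ∀ y, PY y = ∑ x, P x * W x y)
    (hcondV : ∀ y, 0 < PY y → 0 < ∑ x, (P x * W x y / PY y) *
      (Real.log (W x y / PY y)
        - ∑ x', (P x' * W x' y / PY y) * Real.log (W x' y / PY y)) ^ 2)
    {C V : ℝ} (hC : C = ∑ x, ∑ y, P x * W x y * Real.log (W x y / PY y))
    (hV : V = ∑ x, ∑ y, P x * W x y * (Real.log (W x y / PY y) - C) ^ 2) (hVpos : 0 < V) :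
    ∃ K : ℝ, 0 ≤ K ∧ ∀ n : ℕ, 1 ≤ n → ∀ γ : ℝ,
      ∑ x : Fin n → X, (∏ t, P (x t)) * ∑ x' : Fin n → X, (∏ t, P (x' t)) *
        ∑ y : Fin n → Y, (∏ t, W (x t) (y t)) *
          (if ¬ ∑ t, Real.log (W (x t) (y t) / PY (y t)) ≤ γ ∧
            ∏ t, W (x t) (y t) ≤ ∏ t, W (x' t) (y t) then (1 : ℝ) else 0)
        ≤ K / n * Real.exp (-γ) := by
  obtain ⟨K₁, hK₁, hback⟩ := exists_sum_prod_indicator_le hP0 hW0 hPY hcondV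
  let p : X × Y → ℝ := fun z => P z.1 * W z.1 z.2
  let η : X × Y → ℝ := fun z => Real.log (W z.1 z.2 / PY z.2) - C
  have hp0 : ∀ z, 0 ≤ p z := fun z => mul_nonneg (hP0 _) (hW0 _ _)
  have hp1 : ∑ z, p z = 1 := by
    simp only [p, Fintype.sum_prod_type, ← Finset.mul_sum, hW1, mul_one, hP1]
  have hmean : ∑ z, p z * η z = 0 := by
    simp only [η, mul_sub, Finset.sum_sub_distrib, ← Finset.sum_mul, hp1, one_mul]
    simp only [p, Fintype.sum_prod_type, hC, sub_self]
  have hvar : ∑ z, p z * η z ^ 2 = V := by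
    simp only [p, η, Fintype.sum_prod_type, hV]
  obtain ⟨B, hB⟩ := (Set.finite_range fun z => |η z|).bddAbove
  refine ⟨K₁ * (4 * Real.exp (2 * B) / Real.sqrt V), by positivity, fun n hn γ => ?_⟩
  have hn0 : (0 : ℝ) < n := by exact_mod_cast hn
  have hswap : ∀ x : Fin n → X, ∑ x' : Fin n → X, (∏ t, P (x' t)) *
      ∑ y : Fin n → Y, (∏ t, W (x t) (y t)) *
        (if ¬ ∑ t, Real.log (W (x t) (y t) / PY (y t)) ≤ γ ∧
          ∏ t, W (x t) (y t) ≤ ∏ t, W (x' t) (y t) then (1 : ℝ) else 0)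
      = ∑ y : Fin n → Y, (∏ t, W (x t) (y t)) *
        ((if ∑ t, Real.log (W (x t) (y t) / PY (y t)) ≤ γ then 0 else 1) *
        ∑ x' : Fin n → X, (∏ t, P (x' t)) *
          (if ∏ t, W (x t) (y t) ≤ ∏ t, W (x' t) (y t) then (1 : ℝ) else 0)) := by
    intro x
    simp only [Finset.mul_sum]
    rw [Finset.sum_comm]
    refine Finset.sum_congr rfl fun y _ => Finset.sum_congr rfl fun x' _ => ?_
    by_cases h1 : ∑ t, Real.log (W (x t) (y t) / PY (y t)) ≤ γ <;>
      by_cases h2 : ∏ t, W (x t) (y t) ≤ ∏ t, W (x' t) (y t) <;> simp [h1, h2, mul_comm]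
  simp only [hswap]
  rw [sum_prod_mul_eq_prodMean P W fun (x : Fin n → X) (y : Fin n → Y) =>
    (if ∑ t, Real.log (W (x t) (y t) / PY (y t)) ≤ γ then 0 else 1) *
        ∑ x' : Fin n → X, (∏ t, P (x' t)) *
          (if ∏ t, W (x t) (y t) ≤ ∏ t, W (x' t) (y t) then (1 : ℝ) else 0)]
  have hconc := prodMean_exp_neg_abs_le (p := fun _ : Fin n => p) (ξ := fun _ => η) (δ := B)
    (fun _ => hp0) (fun _ => hp1) (fun _ z => hB ⟨z, rfl⟩) (fun _ => hmean)
    (σ := Real.sqrt n * Real.sqrt V) (by positivity)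
    (by rw [Finset.sum_const, Finset.card_univ, Fintype.card_fin, nsmul_eq_mul, mul_pow,
      Real.sq_sqrt hn0.le, Real.sq_sqrt hVpos.le, hvar]) (γ - n * C)
  refine le_trans ?_ ((mul_le_mul_of_nonneg_left hconc
    (by positivity : 0 ≤ K₁ / Real.sqrt n * Real.exp (-γ))).trans (le_of_eq ?_))
  · rw [← prodMean_const_mul]
    refine prodMean_mono_of_pos (fun _ => hp0) fun z hz => ?_
    have hη : ∑ t, η (z t) - (γ - n * C)
        = ∑ t, Real.log (W (z t).1 (z t).2 / PY (z t).2) - γ := by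
      simp [η, Finset.sum_sub_distrib]
    rw [hη]
    have hWpos : ∀ t, 0 < W (z t).1 (z t).2 := fun t =>
      (hW0 _ _).lt_of_ne' (right_ne_zero_of_mul (hz t).ne')
    have hYpos : ∀ t, 0 < PY (z t).2 := fun t => by
      rw [hPY]
      exact (hz t).trans_le (Finset.single_le_sum (f := fun x => P x * W x (z t).2)
        (fun x _ => mul_nonneg (hP0 x) (hW0 x _)) (Finset.mem_univ (z t).1))
    split_ifs with h
    · rw [zero_mul]; positivity
    · rw [one_mul]
      refine (hback n hn _ _ hWpos hYpos).trans (le_of_eq ?_)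
      rw [abs_of_pos (sub_pos.2 (not_le.1 h)), mul_assoc, ← Real.exp_add]
      congr 2
      ring
  · have hsq : Real.sqrt n * Real.sqrt n = n := Real.mul_self_sqrt hn0.le
    calc _ = K₁ * (4 * Real.exp (2 * B) / Real.sqrt V) / (Real.sqrt n * Real.sqrt n)
          * Real.exp (-γ) := by field_simp
      _ = _ := by rw [hsq]

/-- **Third-order-optimal achievability for the DMC.**
For a DMC with capacity-achieving input distribution `P` (capacity
`C = I(P) > 0`, dispersion `V = Var[i(X;Y)] > 0`, `Var[i(X;Y)|Y] > 0`,
`T = E[|i−C|³] < ∞`), for every `0 < ε < 1` there exist a constant `K` and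
`N` such that for every `n ≥ N` there is a blocklength-`n` code with `M`
codewords and average error probability at most `ε` with
`log M ≥ nC − √(nV)·Q⁻¹(ε) + (1/2) log n − K`. -/
theorem third_order_achievability
    {X Y : Type*} [Fintype X] [Fintype Y]
    (W : X → Y → ℝ) (hW0 : ∀ x y, 0 ≤ W x y) (hW1 : ∀ x, ∑ y, W x y = 1)
    (P : X → ℝ) (hP0 : ∀ x, 0 ≤ P x) (hP1 : ∑ x, P x = 1)
    (PY : Y → ℝ) (hPY : ∀ y, PY y = ∑ x, P x * W x y)
    (i1 : X → Y → ℝ) (hi1 : ∀ x y, i1 x y = Real.log (W x y / PY y))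
    (C V T : ℝ)
    (hC : C = ∑ x, ∑ y, P x * W x y * i1 x y) (hCpos : 0 < C)
    (hCap : ∀ P' : X → ℝ, (∀ x, 0 ≤ P' x) → (∑ x, P' x = 1) →
      (∑ x, ∑ y, P' x * W x y * Real.log (W x y / ∑ x', P' x' * W x' y)) ≤ C)
    (hV : V = ∑ x, ∑ y, P x * W x y * (i1 x y - C) ^ 2) (hVpos : 0 < V)
    (hT : T = ∑ x, ∑ y, P x * W x y * |i1 x y - C| ^ 3)
    (hcondV : ∀ y, 0 < PY y →
      0 < ∑ x, (P x * W x y / PY y) *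
        (i1 x y - ∑ x', (P x' * W x' y / PY y) * i1 x' y) ^ 2)
    (ε : ℝ) (hε0 : 0 < ε) (hε1 : ε < 1)
    (Qinv : ℝ) (hQinv : Qfun Qinv = ε) :
    ∃ K : ℝ, ∃ N : ℕ, ∀ n : ℕ, N ≤ n →
      ∃ (M : ℕ) (f : Fin M → Fin n → X) (g : (Fin n → Y) → Fin M),
        1 ≤ M ∧
        ((M : ℝ)⁻¹ * ∑ j : Fin M, ∑ y : Fin n → Y,
            (∏ t, W (f j t) (y t)) * (if g y = j then 0 else 1)) ≤ ε ∧
        (n : ℝ) * C - Real.sqrt ((n : ℝ) * V) * Qinv + (1 / 2) * Real.log n - K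
          ≤ Real.log M := by
  obtain rfl : i1 = fun x y => Real.log (W x y / PY y) := by ext x y; exact hi1 x y
  obtain ⟨K₀, hK₀, hunion⟩ := exists_union_bound_le hP0 hP1 hW0 hW1 hPY hcondV hC hV hVpos
  obtain ⟨φ, hφ, hdec⟩ := exists_Qfun_add_le Qinv
  let p : X × Y → ℝ := fun z => P z.1 * W z.1 z.2
  let η : X × Y → ℝ := fun z => Real.log (W z.1 z.2 / PY z.2) - C
  have hp0 : ∀ z, 0 ≤ p z := fun z => mul_nonneg (hP0 _) (hW0 _ _)
  have hp1 : ∑ z, p z = 1 := by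
    simp only [p, Fintype.sum_prod_type, ← Finset.mul_sum, hW1, mul_one, hP1]
  have hmean : ∑ z, p z * η z = 0 := by
    simp only [η, mul_sub, Finset.sum_sub_distrib, ← Finset.sum_mul, hp1, one_mul]
    simp only [p, Fintype.sum_prod_type, hC, sub_self]
  have hvar : ∑ z, p z * η z ^ 2 = V := by
    simp only [p, η, Fintype.sum_prod_type, hV]
  obtain ⟨B, hB0, hηB⟩ : ∃ B : ℝ, 0 ≤ B ∧ ∀ z, |η z| ≤ B := by
    obtain ⟨B, hB⟩ := (Set.finite_range fun z => |η z|).bddAbove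
    exact ⟨max B 0, le_max_right _ _, fun z => (hB ⟨z, rfl⟩).trans (le_max_left _ _)⟩
  set D₁ := B / Real.sqrt V with hD₁
  have hD₁0 : 0 ≤ D₁ := by positivity
  set D := 8 * D₁ + 4 * D₁ ^ 2 + K₀ + 1 with hD
  have hD0 : 0 < D := by positivity
  refine ⟨Real.sqrt V * (D / φ + 2 * D₁), max 1 ⌈(D / φ) ^ 2⌉₊, fun n hn => ?_⟩
  have hn1 : 1 ≤ n := (le_max_left _ _).trans hn
  have hn1' : (1 : ℝ) ≤ n := by exact_mod_cast hn1
  have hn2 : (D / φ) ^ 2 ≤ n := Nat.ceil_le.1 ((le_max_right _ _).trans hn)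
  have hbe := prodMean_iid_indicator_le_Qfun hp0 hp1 hB0 hηB hmean hvar hVpos hn1
    (Qinv + D / φ / Real.sqrt n)
  set s := Real.sqrt n with hs
  have hs1 : 1 ≤ s := Real.one_le_sqrt.2 hn1'
  have hs0 : 0 < s := one_pos.trans_le hs1
  have hss : s ^ 2 = n := Real.sq_sqrt (zero_le_one.trans hn1')
  set γ := n * C - s * Real.sqrt V * (Qinv + D / φ / s + 2 * (D₁ / s)) with hγ
  have hxpos : 0 < s * Real.exp γ := by positivity
  set M := ⌈s * Real.exp γ⌉₊ with hM
  have hM1 : 1 ≤ M := Nat.one_le_iff_ne_zero.2 (Nat.ceil_pos.2 hxpos).ne'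
  obtain ⟨f, g, hfg⟩ := exists_code_le (p := fun x : Fin n → X => ∏ t, P (x t))
    (w := fun x (y : Fin n → Y) => ∏ t, W (x t) (y t))
    (fun x => Finset.prod_nonneg fun t _ => hP0 _)
    (by simpa [prodMean] using prodMean_one (p := fun _ : Fin n => P) fun _ => hP1)
    (fun x y => Finset.prod_nonneg fun t _ => hW0 _ _) hM1
    (fun x y => ∑ t, Real.log (W (x t) (y t) / PY (y t)) ≤ γ)
  refine ⟨M, f, g, hM1, hfg.trans ?_, ?_⟩
  · have hbad : ∑ x : Fin n → X, (∏ t, P (x t)) * ∑ y : Fin n → Y, (∏ t, W (x t) (y t)) *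
        (if ∑ t, Real.log (W (x t) (y t) / PY (y t)) ≤ γ then (1 : ℝ) else 0)
        ≤ Qfun (Qinv + D / φ / s) + 8 * (D₁ / s) + 4 * (D₁ / s) ^ 2 := by
      rw [sum_prod_mul_eq_prodMean P W fun (x : Fin n → X) (y : Fin n → Y) =>
        if ∑ t, Real.log (W (x t) (y t) / PY (y t)) ≤ γ then (1 : ℝ) else 0]
      refine le_of_eq_of_le (congrArg _ (funext fun z => ?_)) hbe
      have hη : ∑ t, η (z t) = ∑ t, Real.log (W (z t).1 (z t).2 / PY (z t).2) - n * C := by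
        simp [η, Finset.sum_sub_distrib]
      refine if_congr ?_ rfl rfl
      rw [hη, sub_le_iff_le_add', ← sub_eq_add_neg]
    have hgood := hunion n hn1 γ
    have hM0 : (0 : ℝ) ≤ (M : ℝ) - 1 := by
      rw [sub_nonneg]; exact_mod_cast hM1
    have hMle : (M : ℝ) - 1 ≤ s * Real.exp γ :=
      sub_le_iff_le_add.2 (Nat.ceil_lt_add_one hxpos.le).le
    have hprod := (mul_le_mul_of_nonneg_left hgood hM0).trans
      (mul_le_mul_of_nonneg_right hMle (by positivity))
    have heq : s * Real.exp γ * (K₀ / n * Real.exp (-γ)) = K₀ / s := by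
      rw [Real.exp_neg, ← hss]; field_simp
    have hsq : (D₁ / s) ^ 2 ≤ D₁ ^ 2 / s := by
      rw [div_pow]
      gcongr
      exact le_self_pow₀ hs1 two_ne_zero
    have hQ := hdec (D / φ / s) (by positivity)
      ((div_le_one hs0).2 (Real.le_sqrt_of_sq_le hn2))
    rw [hQinv, show φ * (D / φ / s) = D / s by field_simp] at hQ
    have hDs : D / s = 8 * (D₁ / s) + 4 * (D₁ ^ 2 / s) + K₀ / s + 1 / s := by
      rw [hD]; ring
    have h1s : 0 ≤ 1 / s := by positivity
    rw [heq] at hprod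
    linarith only [hbad, hprod, hsq, hQ, hDs, h1s]
  · have hlog : Real.log (s * Real.exp γ) ≤ Real.log M :=
      Real.log_le_log hxpos (Nat.le_ceil _)
    have hγ' : γ = n * C - s * Real.sqrt V * Qinv - Real.sqrt V * (D / φ + 2 * D₁) := by
      rw [hγ]; field_simp; ring
    rw [Real.log_mul hs0.ne' (Real.exp_pos γ).ne', Real.log_exp, hs,
      Real.log_sqrt (zero_le_one.trans hn1'), hγ'] at hlog
    rw [Real.sqrt_mul (zero_le_one.trans hn1') V]
    linarith only [hlog]
end
end

section
/- For Gallager's function E₀(ρ, P_X) of a DMC with output alphabet Y, the second derivative satisfies −E₀''(ρ, P_X) ≤ 4/e² + (ln|Y|)² − (E₀'(ρ, P_X))² for all ρ ≥ 0. -/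
open scoped BigOperators
open Real

lemma sq_sub_sq_le_cosh_sub_cosh {m : ℝ} (hm : 0 < m) (x : ℝ) :
    x ^ 2 - m ^ 2 ≤ 2 * m / sinh m * (cosh x - cosh m) := by
  have hs : 0 < sinh m := sinh_pos_iff.2 hm
  have hconv : ConvexOn ℝ (Set.Ici 0) sinh := by
    refine convexOn_of_deriv2_nonneg (convex_Ici 0) continuous_sinh.continuousOn
      differentiable_sinh.differentiableOn (by simpa using differentiable_cosh.differentiableOn) ?_
    intro x hx
    simp only [interior_Ici, Set.mem_Ioi] at hx
    simpa using hx.le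
  set f : ℝ → ℝ := fun x ↦ 2 * m / sinh m * cosh x - x ^ 2 with hf
  have hd (x : ℝ) : HasDerivAt f (2 * m / sinh m * sinh x - 2 * x) x := by
    refine (((hasDerivAt_cosh x).const_mul (2 * m / sinh m)).fun_sub
      (hasDerivAt_pow 2 x)).congr_deriv ?_
    norm_num
  have hcont : Continuous f := by fun_prop
  have key : ∀ x, 0 ≤ x → f m ≤ f x := by
    intro x hx
    rcases le_total x m with h | h
    · refine antitoneOn_of_deriv_nonpos (convex_Icc 0 m) hcont.continuousOn
        (fun y _ ↦ (hd y).differentiableAt.differentiableWithinAt) ?_ ⟨hx, h⟩ ⟨hm.le, le_rfl⟩ h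
      intro y hy
      rw [interior_Icc] at hy
      have h1 : 0 ≤ 1 - y / m := by rw [sub_nonneg, div_le_one hm]; exact hy.2.le
      have := hconv.2 (y := m) Set.self_mem_Ici hm.le h1 (div_nonneg hy.1.le hm.le) (by ring)
      simp only [smul_eq_mul, mul_zero, zero_add, sinh_zero, div_mul_cancel₀ y hm.ne'] at this
      rw [(hd y).deriv, sub_nonpos]
      calc 2 * m / sinh m * sinh y ≤ 2 * m / sinh m * (y / m * sinh m) := by gcongr
        _ = 2 * y := by field_simp
    · refine monotoneOn_of_deriv_nonneg (convex_Ici m) hcont.continuousOn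
        (fun y _ ↦ (hd y).differentiableAt.differentiableWithinAt) ?_ Set.self_mem_Ici h h
      intro y hy
      rw [interior_Ici, Set.mem_Ioi] at hy
      have hy0 : 0 < y := hm.trans hy
      have h1 : 0 ≤ 1 - m / y := by rw [sub_nonneg, div_le_one hy0]; exact hy.le
      have := hconv.2 (y := y) Set.self_mem_Ici hy0.le h1 (div_nonneg hm.le hy0.le) (by ring)
      simp only [smul_eq_mul, mul_zero, zero_add, sinh_zero, div_mul_cancel₀ m hy0.ne'] at this
      rw [(hd y).deriv, sub_nonneg]
      calc 2 * y = 2 * y / sinh m * sinh m := by field_simp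
        _ ≤ 2 * y / sinh m * (m / y * sinh y) := by gcongr
        _ = 2 * m / sinh m * sinh y := by field_simp
  have := key |x| (abs_nonneg x)
  simp only [hf, cosh_abs, sq_abs] at this
  linarith

lemma mul_log_sq_le {μ : ℝ} (hμ : 1 < μ) {t : ℝ} (ht : 0 ≤ t) :
    t * log t ^ 2 ≤ 2 * log μ / (μ - μ⁻¹) +
      (log μ ^ 2 - 2 * log μ / (μ - μ⁻¹) * (μ + μ⁻¹)) * t +
        2 * log μ / (μ - μ⁻¹) * t ^ 2 := by
  have hm : 0 < log μ := log_pos hμ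
  have hμ0 : 0 < μ := by linarith
  have hinv : μ⁻¹ < μ := (inv_lt_one_of_one_lt₀ hμ).trans hμ
  have hd : 0 < μ - μ⁻¹ := sub_pos.2 hinv
  rcases ht.eq_or_lt with rfl | ht
  · have : 0 ≤ 2 * log μ / (μ - μ⁻¹) := by positivity
    simpa using this
  have h := sq_sub_sq_le_cosh_sub_cosh hm (log t)
  rw [sinh_log hμ0, cosh_log hμ0, cosh_log ht] at h
  have h2 := mul_le_mul_of_nonneg_left h ht.le
  have e : t * (2 * log μ / ((μ - μ⁻¹) / 2) * ((t + t⁻¹) / 2 - (μ + μ⁻¹) / 2)) =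
      2 * log μ / (μ - μ⁻¹) * (t ^ 2 + 1 - t * (μ + μ⁻¹)) := by
    field_simp
  rw [e] at h2
  linarith

lemma exists_coeff_mul_log_sq_le {N : ℕ} (hN : 1 ≤ N) :
    ∃ a b : ℝ, 0 ≤ a ∧ (∀ t : ℝ, 0 ≤ t → t * log t ^ 2 ≤ a + b * t + a * t ^ 2) ∧
      a + b + a * N ≤ 4 / exp 1 ^ 2 + log N ^ 2 := by
  suffices ∃ μ : ℝ, 1 < μ ∧ 2 * log μ / (μ - μ⁻¹) * (N + 1 - (μ + μ⁻¹)) + log μ ^ 2 ≤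
      4 / exp 1 ^ 2 + log N ^ 2 by
    obtain ⟨μ, hμ, h⟩ := this
    refine ⟨_, _, ?_, fun t ht ↦ mul_log_sq_le hμ ht, by linarith⟩
    have := log_pos hμ
    have := (inv_lt_one_of_one_lt₀ hμ).trans hμ
    exact div_nonneg (by positivity) (by linarith)
  have he : (0.5413 : ℝ) ≤ 4 / exp 1 ^ 2 := by
    rw [le_div_iff₀ (by positivity)]
    have := exp_one_lt_d9
    nlinarith [exp_pos 1]
  have h2 := log_two_gt_d9
  have h2' := log_two_lt_d9
  have h3 := log_three_gt_d9
  have h3' := log_three_lt_d9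
  have h5 := log_five_gt_d9
  have h5' := log_five_lt_d9
  have h4 : log 4 = 2 * log 2 := by
    rw [show (4 : ℝ) = 2 ^ 2 by norm_num, log_pow]; norm_num
  rcases lt_or_ge N 5 with h | h
  · refine ⟨N + 1, by simpa using (by lia : 0 < N), ?_⟩
    generalize 4 / exp 1 ^ 2 = δ at he ⊢
    interval_cases N <;> norm_num [h4] <;> nlinarith
  · refine ⟨N, by exact_mod_cast (by lia : 1 < N), ?_⟩
    have hN' : (5 : ℝ) ≤ N := by exact_mod_cast h
    have e : 2 * log N / (N - (N : ℝ)⁻¹) * (N + 1 - (N + (N : ℝ)⁻¹)) = 2 * log N / (N + 1) := by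
      have : (N : ℝ) - 1 ≠ 0 := by linarith
      have : (N : ℝ) ^ 2 - 1 ≠ 0 := by nlinarith
      field_simp
      ring
    rw [e]
    refine add_le_add_left ?_ _
    rcases h.eq_or_lt with rfl | h
    · refine le_trans ?_ he
      norm_num
      linarith
    · have hN' : (6 : ℝ) ≤ N := by exact_mod_cast h
      have hlog : log N ≤ 1 + N / exp 1 ^ 2 := by
        have := log_le_sub_one_of_pos (x := N / exp 1 ^ 2) (by positivity)
        rw [log_div (by positivity) (by positivity), log_pow, log_exp] at this
        push_cast at this
        linarith
      rw [div_le_div_iff₀ (by positivity) (by positivity)]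
      have he2 : exp 1 ^ 2 ≤ 8 := by
        have := exp_one_lt_d9
        nlinarith [exp_pos 1]
      calc 2 * log N * exp 1 ^ 2 ≤ 2 * (1 + N / exp 1 ^ 2) * exp 1 ^ 2 := by gcongr
        _ = 2 * exp 1 ^ 2 + 2 * N := by field_simp
        _ ≤ 4 * (N + 1) := by linarith

lemma hasDerivAt_rpow_inv {w s : ℝ} (hw : 0 ≤ w) (hs : 0 < s) :
    HasDerivAt (fun s : ℝ ↦ w ^ (1 / s)) (-(w ^ (1 / s) * log w) / s ^ 2) s := by
  rcases hw.eq_or_lt with rfl | hw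
  · simp only [log_zero, mul_zero, neg_zero, zero_div]
    refine (hasDerivAt_const s (0 : ℝ)).congr_of_eventuallyEq ?_
    filter_upwards [eventually_gt_nhds hs] with r hr
    exact zero_rpow (by positivity)
  · have h := (hasDerivAt_inv hs.ne').const_rpow hw
    simp only [one_div]
    convert h using 1
    ring

/-- The moments `∑ x, P x * w x ^ (1 / s) * log (w x) ^ k`. -/
noncomputable def logMoment {X : Type*} [Fintype X] (P w : X → ℝ) (k : ℕ) (s : ℝ) : ℝ :=
  ∑ x, P x * w x ^ (1 / s) * log (w x) ^ k

section
variable {X : Type*} [Fintype X] {P w : X → ℝ}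

lemma hasDerivAt_logMoment (hw : ∀ x, 0 ≤ w x) (k : ℕ) {s : ℝ} (hs : 0 < s) :
    HasDerivAt (logMoment P w k) (-logMoment P w (k + 1) s / s ^ 2) s := by
  have := HasDerivAt.fun_sum (u := Finset.univ) fun x _ ↦
    ((hasDerivAt_rpow_inv (hw x) hs).const_mul (P x)).mul_const (log (w x) ^ k)
  refine this.congr_deriv ?_
  simp only [logMoment, neg_div, Finset.sum_div, ← Finset.sum_neg_distrib]
  refine Finset.sum_congr rfl fun x _ ↦ ?_
  ring

lemma logMoment_zero_nonneg (hP : ∀ x, 0 ≤ P x) (hw : ∀ x, 0 ≤ w x) (s : ℝ) :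
    0 ≤ logMoment P w 0 s :=
  Finset.sum_nonneg fun x _ ↦ by have := hP x; have := hw x; positivity

lemma logMoment_zero_eq_zero_iff (hP : ∀ x, 0 ≤ P x) (hw : ∀ x, 0 ≤ w x) {s : ℝ} (hs : 0 < s) :
    logMoment P w 0 s = 0 ↔ ∀ x, P x = 0 ∨ w x = 0 := by
  rw [logMoment, Finset.sum_eq_zero_iff_of_nonneg
    fun x _ ↦ by have := hP x; have := hw x; positivity]
  simp [rpow_eq_zero (hw _) (inv_pos.2 hs).ne']

lemma logMoment_zero_pos_iff (hP : ∀ x, 0 ≤ P x) (hw : ∀ x, 0 ≤ w x) {s r : ℝ}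
    (hs : 0 < s) (hr : 0 < r) : 0 < logMoment P w 0 s ↔ 0 < logMoment P w 0 r := by
  rw [(logMoment_zero_nonneg hP hw s).lt_iff_ne', (logMoment_zero_nonneg hP hw r).lt_iff_ne',
    Ne, Ne, logMoment_zero_eq_zero_iff hP hw hs, logMoment_zero_eq_zero_iff hP hw hr]

/-- The logarithmic derivative of `s ↦ logMoment P w 0 s ^ s`. -/
noncomputable def logDerivPow (P w : X → ℝ) (s : ℝ) : ℝ :=
  log (logMoment P w 0 s) - logMoment P w 1 s / (s * logMoment P w 0 s)

lemma hasDerivAt_logMoment_rpow (hP : ∀ x, 0 ≤ P x) (hw : ∀ x, 0 ≤ w x) {s : ℝ} (hs : 0 < s) :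
    HasDerivAt (fun s ↦ logMoment P w 0 s ^ s) (logMoment P w 0 s ^ s * logDerivPow P w s) s := by
  rcases (logMoment_zero_nonneg hP hw s).eq_or_lt with h | h
  · rw [← h, zero_rpow hs.ne', zero_mul]
    refine (hasDerivAt_const s (0 : ℝ)).congr_of_eventuallyEq ?_
    filter_upwards [eventually_gt_nhds hs] with r hr
    rw [(logMoment_zero_eq_zero_iff hP hw hr).2
      ((logMoment_zero_eq_zero_iff hP hw hs).1 h.symm), zero_rpow hr.ne']
  · refine ((hasDerivAt_logMoment hw 0 hs).rpow (hasDerivAt_id s) h).congr_deriv ?_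
    rw [logDerivPow, id, rpow_sub_one h.ne']
    field_simp
    ring

lemma hasDerivAt_logDerivPow (hw : ∀ x, 0 ≤ w x) {s : ℝ} (hs : 0 < s)
    (h : 0 < logMoment P w 0 s) :
    HasDerivAt (logDerivPow P w)
      ((logMoment P w 2 s / logMoment P w 0 s - (logMoment P w 1 s / logMoment P w 0 s) ^ 2)
        / s ^ 3) s := by
  have h0 := hasDerivAt_logMoment (P := P) hw 0 hs
  have h1 := hasDerivAt_logMoment (P := P) hw 1 hs
  refine ((h0.log h.ne').fun_sub (h1.fun_div ((hasDerivAt_id s).fun_mul h0)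
    (mul_pos hs h).ne')).congr_deriv ?_
  simp only [id]
  field_simp
  ring

/-- The second derivative of `s ↦ logMoment P w 0 s ^ s`. -/
noncomputable def derivTwoPow (P w : X → ℝ) (s : ℝ) : ℝ :=
  logMoment P w 0 s ^ s * (logDerivPow P w s ^ 2 +
    (logMoment P w 2 s / logMoment P w 0 s - (logMoment P w 1 s / logMoment P w 0 s) ^ 2) / s ^ 3)

lemma hasDerivAt_logMoment_rpow_mul_logDerivPow (hP : ∀ x, 0 ≤ P x) (hw : ∀ x, 0 ≤ w x)
    {s : ℝ} (hs : 0 < s) :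
    HasDerivAt (fun s ↦ logMoment P w 0 s ^ s * logDerivPow P w s) (derivTwoPow P w s) s := by
  rcases (logMoment_zero_nonneg hP hw s).eq_or_lt with h | h
  · rw [derivTwoPow, ← h, zero_rpow hs.ne', zero_mul]
    refine (hasDerivAt_const s (0 : ℝ)).congr_of_eventuallyEq ?_
    filter_upwards [eventually_gt_nhds hs] with r hr
    rw [(logMoment_zero_eq_zero_iff hP hw hr).2
      ((logMoment_zero_eq_zero_iff hP hw hs).1 h.symm), zero_rpow hr.ne', zero_mul]
  · refine ((hasDerivAt_logMoment_rpow hP hw hs).fun_mul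
      (hasDerivAt_logDerivPow hw hs h)).congr_deriv ?_
    rw [derivTwoPow]
    ring

lemma derivTwoPow_le (hP : ∀ x, 0 ≤ P x) (hP1 : ∑ x, P x = 1) (hw : ∀ x, 0 ≤ w x)
    (hw1 : ∀ x, w x ≤ 1) {s a b : ℝ} (hs : 1 ≤ s) (ha : 0 ≤ a)
    (hab : ∀ t : ℝ, 0 ≤ t → t * log t ^ 2 ≤ a + b * t + a * t ^ 2) :
    derivTwoPow P w s ≤
      (a + b) * logMoment P w 0 s ^ s + a * logMoment P w 0 s ^ (s - 1) := by
  have hs0 : 0 < s := by linarith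
  rcases (logMoment_zero_nonneg hP hw s).eq_or_lt with h | h
  · rw [derivTwoPow, ← h, zero_rpow hs0.ne', zero_mul]
    have := zero_rpow_nonneg (s - 1)
    simp only [mul_zero, zero_add]
    positivity
  set A := logMoment P w 0 s with hA
  set B := logMoment P w 1 s with hB
  set C := logMoment P w 2 s with hC
  set t : X → ℝ := fun x ↦ w x ^ (1 / s) / A with ht
  have ht0 (x) : 0 ≤ t x := div_nonneg (rpow_nonneg (hw x) _) h.le
  have hsum : ∑ x, P x * t x = 1 := by
    have : ∑ x, P x * t x = A / A := by
      rw [hA, logMoment, Finset.sum_div]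
      refine Finset.sum_congr rfl fun x _ ↦ ?_
      simp only [ht, hA, logMoment]
      ring
    rw [this, div_self h.ne']
  have hvar : B ^ 2 ≤ A * C := by
    refine Finset.sum_sq_le_sum_mul_sum_of_sq_le_mul _ (fun x _ ↦ ?_) (fun x _ ↦ ?_)
      fun x _ ↦ ?_
    · have := hP x; have := hw x; positivity
    · have := hP x; have := hw x; positivity
    · exact le_of_eq (by ring)
  have hterm (x) : t x * (log (w x) / s - log A) ^ 2 ≤ a + b * t x + a * (t x / A) := by
    rcases (hw x).eq_or_lt with h0 | h0
    · simp [ht, ← h0, zero_rpow (inv_pos.2 hs0).ne', ha]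
    have hlog : log (t x) = log (w x) / s - log A := by
      simp only [ht]
      rw [log_div (rpow_pos_of_pos h0 _).ne' h.ne', log_rpow h0]
      ring
    rw [← hlog]
    have hle : t x ≤ 1 / A := by
      simp only [ht]
      gcongr
      exact rpow_le_one (hw x) (hw1 x) (by positivity)
    calc _ ≤ a + b * t x + a * t x ^ 2 := hab _ (ht0 x)
      _ = a + b * t x + a * (t x * t x) := by ring
      _ ≤ a + b * t x + a * (t x * (1 / A)) := by
        have := ht0 x
        gcongr
      _ = _ := by ring
  have hE : ∑ x, P x * (t x * (log (w x) / s - log A) ^ 2) ≤ a + b + a / A := by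
    calc _ ≤ ∑ x, P x * (a + b * t x + a * (t x / A)) :=
          Finset.sum_le_sum fun x _ ↦ mul_le_mul_of_nonneg_left (hterm x) (hP x)
      _ = a * ∑ x, P x + (b + a / A) * ∑ x, P x * t x := by
        rw [Finset.mul_sum, Finset.mul_sum, ← Finset.sum_add_distrib]
        exact Finset.sum_congr rfl fun x _ ↦ by ring
      _ = _ := by rw [hP1, hsum]; ring
  have hexp : ∑ x, P x * (t x * (log (w x) / s - log A) ^ 2) =
      C / (s ^ 2 * A) - 2 * log A * B / (s * A) + log A ^ 2 := by
    calc _ = C / (s ^ 2 * A) - 2 * log A * B / (s * A) + log A ^ 2 * ∑ x, P x * t x := by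
          simp only [hC, hB, logMoment, Finset.sum_div, Finset.mul_sum]
          rw [← Finset.sum_sub_distrib, ← Finset.sum_add_distrib]
          refine Finset.sum_congr rfl fun x _ ↦ ?_
          simp only [ht]
          field_simp
          ring
      _ = _ := by rw [hsum, mul_one]
  have hV : 0 ≤ C / A - (B / A) ^ 2 := by
    rw [div_pow, sub_nonneg, div_le_div_iff₀ (by positivity) h]
    nlinarith
  have hV' : (C / A - (B / A) ^ 2) / s ^ 3 ≤ (C / A - (B / A) ^ 2) / s ^ 2 :=
    div_le_div_of_nonneg_left hV (by positivity) (pow_le_pow_right₀ hs (by norm_num))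
  calc derivTwoPow P w s
      ≤ A ^ s * ((log A - B / (s * A)) ^ 2 + (C / A - (B / A) ^ 2) / s ^ 2) := by
        rw [derivTwoPow, logDerivPow]
        gcongr
    _ = A ^ s * (C / (s ^ 2 * A) - 2 * log A * B / (s * A) + log A ^ 2) := by
        field_simp
        ring
    _ ≤ A ^ s * (a + b + a / A) := by
        rw [← hexp]
        gcongr
    _ = _ := by
        rw [rpow_sub_one h.ne']
        ring

end

lemma sum_rpow_sub_one_le_card_mul {Y : Type*} [Fintype Y] {A : Y → ℝ} (hA : ∀ y, 0 ≤ A y)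
    (hA1 : 1 ≤ ∑ y, A y) {s : ℝ} (hs : 1 ≤ s) :
    ∑ y, A y ^ (s - 1) ≤ Fintype.card Y * ∑ y, A y ^ s := by
  have hmono : Monovary (fun y ↦ A y ^ (s - 1)) A := fun i j hij ↦
    rpow_le_rpow (hA i) hij.le (by linarith)
  calc ∑ y, A y ^ (s - 1) ≤ (∑ y, A y ^ (s - 1)) * ∑ y, A y :=
        le_mul_of_one_le_right (Finset.sum_nonneg fun y _ ↦ rpow_nonneg (hA y) _) hA1
    _ ≤ Fintype.card Y * ∑ y, A y ^ (s - 1) * A y := by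
        exact_mod_cast hmono.sum_mul_sum_le_card_mul_sum
    _ = Fintype.card Y * ∑ y, A y ^ s := by
        congr 1
        refine Finset.sum_congr rfl fun y _ ↦ ?_
        rw [← rpow_add_one' (hA y) (by linarith), sub_add_cancel]

/-- **Gallager's Exercise 5.23 curvature bound.**
For Gallager's function `E₀(ρ,P) = −ln ∑_y (∑_x P x · W x y^{1/(1+ρ)})^{1+ρ}`
of a discrete channel with finite output alphabet `Y`, the second derivative
satisfies `−E₀''(ρ) ≤ 4/e² + (ln |Y|)² − (E₀'(ρ))²` for all `ρ ≥ 0`. -/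
theorem gallager_E0_curvature_bound
    {X Y : Type*} [Fintype X] [Fintype Y]
    (W : X → Y → ℝ) (hW0 : ∀ x y, 0 ≤ W x y) (hW1 : ∀ x, ∑ y, W x y = 1)
    (P : X → ℝ) (hP0 : ∀ x, 0 ≤ P x) (hP1 : ∑ x, P x = 1)
    (E0 : ℝ → ℝ)
    (hE0 : ∀ ρ : ℝ, E0 ρ =
      -Real.log (∑ y, (∑ x, P x * W x y ^ (1 / (1 + ρ))) ^ (1 + ρ))) :
    ∀ ρ : ℝ, 0 ≤ ρ →
      -(deriv (deriv E0) ρ) ≤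
        4 / Real.exp 1 ^ 2 + Real.log (Fintype.card Y) ^ 2 - deriv E0 ρ ^ 2 := by
  intro ρ hρ
  set w : Y → X → ℝ := fun y x ↦ W x y with hw
  have hw0 (y x) : 0 ≤ w y x := hW0 x y
  have hw1 (y x) : w y x ≤ 1 :=
    (Finset.single_le_sum (fun z _ ↦ hW0 x z) (Finset.mem_univ y)).trans (hW1 x).le
  have hA0 (y s) := logMoment_zero_nonneg hP0 (hw0 y) s
  set F : ℝ → ℝ := fun s ↦ ∑ y, logMoment P (w y) 0 s ^ s with hF
  set F' : ℝ → ℝ := fun s ↦ ∑ y, logMoment P (w y) 0 s ^ s * logDerivPow P (w y) s with hF'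
  set F'' : ℝ → ℝ := fun s ↦ ∑ y, derivTwoPow P (w y) s with hF''
  have hdF {s : ℝ} (hs : 0 < s) : HasDerivAt F (F' s) s :=
    HasDerivAt.fun_sum fun y _ ↦ hasDerivAt_logMoment_rpow hP0 (hw0 y) hs
  have hdF' {s : ℝ} (hs : 0 < s) : HasDerivAt F' (F'' s) s :=
    HasDerivAt.fun_sum fun y _ ↦ hasDerivAt_logMoment_rpow_mul_logDerivPow hP0 (hw0 y) hs
  have hsumW : ∑ y, ∑ x, P x * w y x = 1 := by
    rw [Finset.sum_comm]
    simp [hw, ← Finset.mul_sum, hW1, hP1]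
  have hFpos {s : ℝ} (hs : 0 < s) : 0 < F s := by
    obtain ⟨y, -, hy⟩ := (Finset.sum_pos_iff_of_nonneg (s := Finset.univ)
      fun y _ ↦ hA0 y 1).1 (by simp [logMoment, hsumW])
    refine Finset.sum_pos' (fun z _ ↦ rpow_nonneg (hA0 z s) s) ⟨y, Finset.mem_univ y, ?_⟩
    exact rpow_pos_of_pos ((logMoment_zero_pos_iff hP0 (hw0 y) one_pos hs).1 hy) s
  have hE : E0 = fun ρ ↦ -log (F (1 + ρ)) := by
    funext r
    simp [hE0, hF, logMoment, hw]
  have hdE {r : ℝ} (hr : -1 < r) : HasDerivAt E0 (-(F' (1 + r) / F (1 + r))) r := by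
    rw [hE]
    have hs : 0 < 1 + r := by linarith
    exact ((hdF hs).comp_const_add 1 r |>.log (hFpos hs).ne').fun_neg
  have hddE : deriv (deriv E0) ρ =
      -((F'' (1 + ρ) * F (1 + ρ) - F' (1 + ρ) * F' (1 + ρ)) / F (1 + ρ) ^ 2) := by
    have hs : 0 < 1 + ρ := by linarith
    have : deriv E0 =ᶠ[nhds ρ] fun r ↦ -(F' (1 + r) / F (1 + r)) := by
      filter_upwards [eventually_gt_nhds (show -1 < ρ by linarith)] with r hr
      exact (hdE hr).deriv
    rw [this.deriv_eq]
    exact (((hdF' hs).comp_const_add 1 ρ).fun_div ((hdF hs).comp_const_add 1 ρ)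
      (hFpos hs).ne').fun_neg.deriv
  rw [hddE, (hdE (by linarith)).deriv]
  set s := 1 + ρ with hs
  have hs1 : 1 ≤ s := by linarith
  have hs0 : 0 < s := by linarith
  have hcard : 1 ≤ Fintype.card Y := by
    rw [Nat.one_le_iff_ne_zero, Ne, Fintype.card_eq_zero_iff]
    intro h
    simp at hsumW
  have hA1 : 1 ≤ ∑ y, logMoment P (w y) 0 s := by
    rw [← hsumW]
    refine Finset.sum_le_sum fun y _ ↦ Finset.sum_le_sum fun x _ ↦ ?_
    rw [pow_zero, mul_one]
    refine mul_le_mul_of_nonneg_left ?_ (hP0 x)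
    exact self_le_rpow_of_le_one (hw0 y x) (hw1 y x) (by rw [div_le_one hs0]; exact hs1)
  obtain ⟨a, b, ha, hab, hle⟩ := exists_coeff_mul_log_sq_le hcard
  have hbound : F'' s ≤ (4 / exp 1 ^ 2 + log (Fintype.card Y) ^ 2) * F s := by
    calc F'' s ≤ ∑ y, ((a + b) * logMoment P (w y) 0 s ^ s +
          a * logMoment P (w y) 0 s ^ (s - 1)) :=
          Finset.sum_le_sum fun y _ ↦ derivTwoPow_le hP0 hP1 (hw0 y) (hw1 y) hs1 ha hab
      _ = (a + b) * F s + a * ∑ y, logMoment P (w y) 0 s ^ (s - 1) := by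
          rw [Finset.sum_add_distrib, Finset.mul_sum, Finset.mul_sum]
      _ ≤ (a + b) * F s + a * (Fintype.card Y * F s) := by
          gcongr
          exact sum_rpow_sub_one_le_card_mul (fun y ↦ hA0 y s) hA1 hs1
      _ = (a + b + a * Fintype.card Y) * F s := by ring
      _ ≤ _ := mul_le_mul_of_nonneg_right hle (hFpos hs0).le
  rw [← div_le_iff₀ (hFpos hs0)] at hbound
  have hFs := (hFpos hs0).ne'
  have e : - -((F'' s * F s - F' s * F' s) / F s ^ 2) = F'' s / F s - (-(F' s / F s)) ^ 2 := by
    field_simp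
  rw [e]
  linarith
end

section
/- Let p(x,y) be a bivariate polynomial (multinomial) with non-negative coefficients, and let α, β > 0 be rationals. Along the sequence of indices n for which the coefficient of x^{αn}y^{βn} in p(x,y)^n is nonzero, this coefficient satisfies ⌊p(x,y)^n⌋_{αn,βn} ≤ inf_{x>0,y>0} p(x,y)^n/(x^{αn} y^{βn}), and lim_{n→∞} (1/n) log ⌊p(x,y)^n⌋_{αn,βn} = log inf_{x>0,y>0} p(x,y)/(x^α y^β). -/
open Filter
open scoped BigOperators Topology

theorem superadditive_lower_bound {S : Set ℕ} {u : ℕ → ℝ}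
    (hS : ∀ m ∈ S, ∀ n ∈ S, m + n ∈ S ∧ u m + u n ≤ u (m + n))
    {m : ℕ} (hm : m ∈ S) (hm0 : 0 < m) :
    ∃ C : ℝ, ∀ n ∈ S, n * (u m / m) - C ≤ u n := by
  classical
  have key : ∀ r : ℕ, ∃ C : ℝ, ∀ n ∈ S, n % m = r → n * (u m / m) - C ≤ u n := by
    intro r
    by_cases h : ∃ n, n ∈ S ∧ n % m = r
    · obtain ⟨h0S, h0r⟩ := Nat.find_spec h
      have hmin : ∀ n ∈ S, n % m = r → Nat.find h ≤ n := fun n h1 h2 => Nat.find_min' h ⟨h1, h2⟩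
      generalize Nat.find h = n₀ at h0S h0r hmin
      have step : ∀ q : ℕ, n₀ + q * m ∈ S ∧ u n₀ + q * u m ≤ u (n₀ + q * m) := by
        intro q
        induction q with
        | zero => simpa using h0S
        | succ q ih =>
          have := hS _ ih.1 _ hm
          rw [Nat.succ_mul, ← add_assoc]
          refine ⟨this.1, ?_⟩
          push_cast
          linarith [ih.2, this.2]
      refine ⟨n₀ * (u m / m) - u n₀, fun n hn hr => ?_⟩
      have hdvd : m ∣ n - n₀ := (Nat.modEq_iff_dvd' (hmin n hn hr)).1 (h0r.trans hr.symm)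
      obtain ⟨q, hq⟩ := hdvd
      have hnq : n = n₀ + q * m := by
        have := hmin n hn hr
        rw [mul_comm] at hq
        omega
      have h2 := (step q).2
      rw [hnq]
      push_cast
      have : (m : ℝ) ≠ 0 := by positivity
      have h3 : ((n₀ : ℝ) + q * m) * (u m / m) = n₀ * (u m / m) + q * u m := by
        field_simp
      linarith
    · exact ⟨0, fun n hn hr => (h ⟨n, hn, hr⟩).elim⟩
  choose C hC using key
  obtain ⟨B, hB⟩ := ((Finset.range m).image C).bddAbove
  refine ⟨B, fun n hn => ?_⟩
  have h1 := hC _ n hn rfl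
  have h2 : C (n % m) ≤ B := hB (by
    simpa using ⟨n % m, Nat.mod_lt _ hm0, rfl⟩)
  linarith

theorem exists_rat_approx {ι : Type*} [Fintype ι] {l : ι → ℝ} (hl : ∀ i, 0 ≤ l i)
    {U : Set (ι → ℝ)} (hU : U ∈ 𝓝 l) :
    ∃ q : ι → ℚ, (∀ i, 0 ≤ q i) ∧ (fun i => (q i : ℝ)) ∈ U ∧
      ∀ c : ι → ℚ, ∑ i, (c i : ℝ) * l i = 0 → ∑ i, c i * q i = 0 := by
  classical
  let W : Submodule ℚ ℝ := Submodule.span ℚ (Set.range l)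
  have : FiniteDimensional ℚ W := FiniteDimensional.span_of_finite ℚ (Set.finite_range l)
  let b := Module.finBasis ℚ W
  let w : ι → W := fun i => ⟨l i, Submodule.subset_span ⟨i, rfl⟩⟩
  have hw : ∀ i, l i = ∑ j, ((b.repr (w i) j : ℚ) : ℝ) * (b j : ℝ) := by
    intro i
    have := congrArg (Subtype.val) (b.sum_repr (w i))
    simp only [Submodule.coe_sum, Submodule.coe_smul, Rat.smul_def] at this
    exact this.symm
  have hr : ∀ j, ∃ r : ℕ → ℚ, Tendsto (fun N => (r N : ℝ)) atTop (𝓝 (b j : ℝ)) := fun j => by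
    obtain ⟨r, -, hr⟩ := Real.exists_seq_rat_strictMono_tendsto (b j : ℝ)
    exact ⟨r, hr.2⟩
  choose r hr using hr
  let q : ℕ → ι → ℚ := fun N i => ∑ j, b.repr (w i) j * r j N
  have hq : Tendsto (fun N i => (q N i : ℝ)) atTop (𝓝 l) := by
    refine tendsto_pi_nhds.2 fun i => ?_
    rw [hw i]
    simp only [q, Rat.cast_sum, Rat.cast_mul]
    exact tendsto_finsetSum _ fun j _ => (hr j).const_mul _
  have hpos : ∀ᶠ N in atTop, ∀ i, 0 ≤ q N i := by
    refine eventually_all.2 fun i => ?_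
    rcases (hl i).eq_or_lt with h | h
    · have : w i = 0 := Subtype.ext h.symm
      exact Eventually.of_forall fun N => by simp [q, this]
    · filter_upwards [(tendsto_pi_nhds.1 hq i).eventually (lt_mem_nhds h)] with N hN
      exact_mod_cast hN.le
  obtain ⟨N, hN1, hN2⟩ := (hpos.and (hq.eventually hU)).exists
  refine ⟨q N, hN1, hN2, fun c hc => ?_⟩
  have h0 : ∑ i, c i • w i = 0 := by
    apply Subtype.ext
    simpa [Rat.smul_def, w] using hc
  have h1 : ∀ j, ∑ i, c i * b.repr (w i) j = 0 := fun j => by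
    have := congrArg (fun z => b.repr z j) h0
    simpa using this
  simp only [q, Finset.mul_sum]
  rw [Finset.sum_comm]
  refine Finset.sum_eq_zero fun j _ => ?_
  simp only [← mul_assoc]
  rw [← Finset.sum_mul, h1, zero_mul]

theorem log_factorial_bounds (n : ℕ) :
    n * Real.log n - n ≤ Real.log (n.factorial) ∧
      Real.log (n.factorial) ≤ n * Real.log n - n + 1 + Real.log n := by
  induction n with
  | zero => simp
  | succ n ih =>
    rcases n.eq_zero_or_pos with rfl | hn
    · simp
    have hn' : (0 : ℝ) < n := by exact_mod_cast hn
    rw [Nat.factorial_succ, Nat.cast_mul, Real.log_mul (by positivity) (by positivity)]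
    push_cast
    have h1 : n * (Real.log (n + 1) - Real.log n) ≤ 1 := by
      rw [← Real.log_div (by positivity) (by positivity)]
      have := Real.log_le_sub_one_of_pos (x := ((n : ℝ) + 1) / n) (by positivity)
      calc _ ≤ (n : ℝ) * (((n : ℝ) + 1) / n - 1) := by gcongr
        _ = 1 := by field_simp; ring
    have h2 : 1 ≤ (n + 1) * (Real.log (n + 1) - Real.log n) := by
      rw [← Real.log_div (by positivity) (by positivity)]
      have := Real.one_sub_inv_le_log_of_pos (x := ((n : ℝ) + 1) / n) (by positivity)
      calc (1 : ℝ) = (n + 1) * (1 - (((n : ℝ) + 1) / n)⁻¹) := by field_simp; ring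
        _ ≤ _ := by gcongr
    constructor <;> nlinarith [ih.1, ih.2]

section
variable {ι E : Type*} [Fintype ι] [NormedAddCommGroup E] [InnerProductSpace ℝ E]
  [FiniteDimensional ℝ E]

theorem exists_regularized_tilt [Nonempty ι] {w : ι → ℝ} (hw : ∀ i, 0 < w i) (v : ι → E) {I : ℝ}
    (hI : ∀ t : E, I ≤ Real.log (∑ i, w i * Real.exp (inner ℝ (v i) t)))
    {ε : ℝ} (hε : 0 < ε) :
    ∃ l ∈ stdSimplex ℝ ι, I ≤ ∑ i, (l i * Real.log (w i) + Real.negMulLog (l i)) ∧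
      ‖∑ i, l i • v i‖ ^ 2 ≤ 4 * ε * (Real.log (∑ i, w i) - I) := by
  let Z : E → ℝ := fun t => ∑ i, w i * Real.exp (inner ℝ (v i) t)
  have hZ : ∀ t, 0 < Z t := fun t =>
    Finset.sum_pos (fun i _ => mul_pos (hw i) (Real.exp_pos _)) Finset.univ_nonempty
  let f : E → ℝ := fun t => Real.log (Z t) + ε * ‖t‖ ^ 2
  have hf : Continuous f := by
    refine Continuous.add (Continuous.log ?_ fun t => (hZ t).ne') (by fun_prop)
    fun_prop
  have hlim : Tendsto f (cocompact E) atTop := by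
    have h1 : Tendsto (fun t : E => I + ε * ‖t‖ ^ 2) (cocompact E) atTop :=
      tendsto_atTop_add_const_left _ _
        (((tendsto_pow_atTop two_ne_zero).comp (tendsto_norm_cocompact_atTop (E := E))).const_mul_atTop hε)
    exact tendsto_atTop_mono (fun t => by simpa [f] using hI t) h1
  obtain ⟨t, ht⟩ := hf.exists_forall_le hlim
  let l : ι → ℝ := fun i => w i * Real.exp (inner ℝ (v i) t) / Z t
  have hlpos : ∀ i, 0 < l i := fun i => div_pos (mul_pos (hw i) (Real.exp_pos _)) (hZ t)
  have hlsum : ∑ i, l i = 1 := by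
    simp only [l]
    rw [← Finset.sum_div]
    exact div_self (hZ t).ne'
  have hgrad : ∀ h : E, inner ℝ (∑ i, l i • v i) h + 2 * ε * inner ℝ t h = 0 := by
    intro h
    have hd : HasDerivAt (fun s : ℝ => Real.log (∑ i, w i * Real.exp (inner ℝ (v i) t + s * inner ℝ (v i) h))
        + ε * (‖t‖ ^ 2 + s * (2 * inner ℝ t h) + s ^ 2 * ‖h‖ ^ 2))
        ((∑ i, w i * (Real.exp (inner ℝ (v i) t) * inner ℝ (v i) h)) / Z t
          + ε * (2 * inner ℝ t h)) 0 := by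
      refine HasDerivAt.add ?_ ?_
      · have h1 : HasDerivAt (fun s : ℝ => ∑ i, w i * Real.exp (inner ℝ (v i) t + s * inner ℝ (v i) h))
            (∑ i, w i * (Real.exp (inner ℝ (v i) t) * inner ℝ (v i) h)) 0 := by
          refine HasDerivAt.fun_sum fun i _ => HasDerivAt.const_mul _ ?_
          have := (((hasDerivAt_id (0 : ℝ)).mul_const (inner ℝ (v i) h)).const_add
            (inner ℝ (v i) t)).exp
          simpa using this
        have h2 := h1.log (by simpa using (hZ t).ne')
        simpa [Z] using h2
      · refine HasDerivAt.const_mul _ ?_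
        have h1 := ((hasDerivAt_id (0 : ℝ)).mul_const (2 * inner ℝ t h)).const_add (‖t‖ ^ 2)
        have h2 := ((hasDerivAt_id (0 : ℝ)).pow 2).mul_const (‖h‖ ^ 2)
        simpa using h1.fun_add h2
    have hmin : IsLocalMin (fun s : ℝ => Real.log (∑ i, w i * Real.exp (inner ℝ (v i) t + s * inner ℝ (v i) h))
        + ε * (‖t‖ ^ 2 + s * (2 * inner ℝ t h) + s ^ 2 * ‖h‖ ^ 2)) 0 := by
      refine Eventually.of_forall fun s => ?_
      have := ht (t + s • h)
      have hn : ‖t + s • h‖ ^ 2 = ‖t‖ ^ 2 + s * (2 * inner ℝ t h) + s ^ 2 * ‖h‖ ^ 2 := by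
        rw [norm_add_sq_real, inner_smul_right, norm_smul, mul_pow, Real.norm_eq_abs, sq_abs]
        ring
      simp only [f, Z, hn, inner_add_right, inner_smul_right] at this
      simpa using this
    have h0 := hmin.hasDerivAt_eq_zero hd
    rw [sum_inner]
    simp only [inner_smul_left, RCLike.conj_to_real]
    have : ∑ i, l i * inner ℝ (v i) h
        = (∑ i, w i * (Real.exp (inner ℝ (v i) t) * inner ℝ (v i) h)) / Z t := by
      rw [Finset.sum_div]
      refine Finset.sum_congr rfl fun i _ => ?_
      simp only [l]
      ring
    rw [this]
    linarith
  have hmean : ∑ i, l i • v i = -(2 * ε) • t := by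
    refine ext_inner_right ℝ fun h => ?_
    have := hgrad h
    rw [inner_smul_left, RCLike.conj_to_real]
    linarith
  refine ⟨l, ⟨fun i => (hlpos i).le, hlsum⟩, ?_, ?_⟩
  · have h1 : ∀ i, l i * Real.log (w i) + Real.negMulLog (l i)
        = l i * Real.log (Z t) - inner ℝ (l i • v i) t := by
      intro i
      have : Real.log (l i) = Real.log (w i) + inner ℝ (v i) t - Real.log (Z t) := by
        simp only [l]
        rw [Real.log_div (mul_pos (hw i) (Real.exp_pos _)).ne' (hZ t).ne',
          Real.log_mul (hw i).ne' (Real.exp_pos _).ne', Real.log_exp]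
      rw [Real.negMulLog, this, inner_smul_left, RCLike.conj_to_real]
      ring
    simp only [h1]
    rw [Finset.sum_sub_distrib, ← Finset.sum_mul, hlsum, ← sum_inner, hmean, inner_smul_left,
      RCLike.conj_to_real, real_inner_self_eq_norm_sq]
    have := hI t
    nlinarith [mul_nonneg hε.le (sq_nonneg ‖t‖)]
  · have h0 := ht 0
    simp only [f, Z, inner_zero_right, Real.exp_zero, mul_one, norm_zero] at h0
    have h1 := hI t
    rw [hmean, norm_smul, mul_pow, Real.norm_eq_abs, sq_abs]
    nlinarith

theorem exists_entropy_ge [Nonempty ι] {w : ι → ℝ} (hw : ∀ i, 0 < w i) (v : ι → E) {I : ℝ}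
    (hI : ∀ t : E, I ≤ Real.log (∑ i, w i * Real.exp (inner ℝ (v i) t))) :
    ∃ l ∈ stdSimplex ℝ ι, I ≤ ∑ i, (l i * Real.log (w i) + Real.negMulLog (l i)) ∧
      ∑ i, l i • v i = 0 := by
  have h := fun n : ℕ => exists_regularized_tilt hw v hI (ε := 1 / ((n : ℝ) + 1)) (by positivity)
  choose l hl hent hmean using h
  obtain ⟨l₀, hl₀, φ, hφ, hlim⟩ := (isCompact_stdSimplex ℝ ι).tendsto_subseq hl
  refine ⟨l₀, hl₀, ?_, ?_⟩
  · have hc : Continuous fun l : ι → ℝ => ∑ i, (l i * Real.log (w i) + Real.negMulLog (l i)) := by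
      have := Real.continuous_negMulLog
      fun_prop
    exact ge_of_tendsto' ((hc.tendsto l₀).comp hlim) fun n => hent (φ n)
  · have hc : Continuous fun l : ι → ℝ => ‖∑ i, l i • v i‖ ^ 2 := by fun_prop
    have h1 : Tendsto (fun n : ℕ => 4 * (1 / ((φ n : ℝ) + 1)) * (Real.log (∑ i, w i) - I)) atTop
        (𝓝 (4 * 0 * (Real.log (∑ i, w i) - I))) :=
      ((tendsto_one_div_add_atTop_nhds_zero_nat.comp hφ.tendsto_atTop).const_mul _).mul_const _
    have h2 := le_of_tendsto_of_tendsto' ((hc.tendsto l₀).comp hlim) h1 fun n => hmean (φ n)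
    have h3 : ‖∑ i, l₀ i • v i‖ ^ 2 = 0 := le_antisymm (by simpa using h2) (sq_nonneg _)
    simpa using h3

end

theorem exists_nat_mul_eq {ι : Type*} [Fintype ι] {q : ι → ℚ} (hq : ∀ i, 0 ≤ q i) :
    ∃ N : ℕ, 0 < N ∧ ∃ k : ι → ℕ, ∀ i, (k i : ℚ) = N * q i := by
  classical
  refine ⟨∏ i, (q i).den, Finset.prod_pos fun i _ => (q i).den_pos, ?_⟩
  have : ∀ i, ∃ k : ℕ, (k : ℚ) = ((∏ j, (q j).den : ℕ) : ℚ) * q i := by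
    intro i
    obtain ⟨m, hm⟩ := Finset.dvd_prod_of_mem (fun j => (q j).den) (Finset.mem_univ i)
    refine ⟨m * (q i).num.toNat, ?_⟩
    have h1 : (((q i).num.toNat : ℕ) : ℚ) = (q i).num := by
      exact_mod_cast Int.toNat_of_nonneg (Rat.num_nonneg.2 (hq i))
    rw [hm]
    push_cast
    rw [h1, ← Rat.den_mul_eq_num]
    ring
  exact ⟨fun i => (this i).choose, fun i => (this i).choose_spec⟩

theorem log_multinomial_ge {ι : Type*} [Fintype ι] {μ : ι → ℝ} (h1 : ∑ i, μ i = 1)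
    {M : ℕ} (k : ι → ℕ) (hk : ∀ i, (k i : ℝ) = M * μ i) :
    M * ∑ i, Real.negMulLog (μ i) - Fintype.card ι * (1 + Real.log M) ≤
      Real.log (Nat.multinomial Finset.univ k) := by
  have hsum : ∑ i, k i = M := by
    have : ((∑ i, k i : ℕ) : ℝ) = M := by
      push_cast
      simp only [hk]
      rw [← Finset.mul_sum, h1, mul_one]
    exact_mod_cast this
  have hspec := Nat.multinomial_spec Finset.univ k
  have hlog : (∑ i, Real.log ((k i).factorial)) + Real.log (Nat.multinomial Finset.univ k)
      = Real.log (M.factorial) := by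
    rw [← hsum, ← hspec, Nat.cast_mul, Nat.cast_prod, Real.log_mul, Real.log_prod]
    · intro i _
      positivity
    · exact Finset.prod_ne_zero_iff.2 fun i _ => by positivity
    · exact_mod_cast (Nat.multinomial_pos _ _).ne'
  have hle : ∀ i, Real.log ((k i).factorial) ≤
      μ i * (M * Real.log M) - M * Real.negMulLog (μ i) - k i + (1 + Real.log M) := by
    intro i
    have hb := (log_factorial_bounds (k i)).2
    have h2 : Real.log (k i) ≤ Real.log M := by
      rcases (k i).eq_zero_or_pos with h | h
      · rw [h]; simpa using Real.log_natCast_nonneg M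
      · refine Real.log_le_log (by exact_mod_cast h) ?_
        exact_mod_cast hsum ▸ Finset.single_le_sum (fun _ _ => Nat.zero_le _) (Finset.mem_univ i)
    have h3 : k i * Real.log (k i) = μ i * (M * Real.log M) - M * Real.negMulLog (μ i) := by
      rw [hk i, Real.negMulLog]
      rcases eq_or_ne (μ i) 0 with h | h
      · simp [h]
      rcases eq_or_ne (M : ℝ) 0 with h' | h'
      · simp [h']
      rw [Real.log_mul h' h]
      ring
    linarith
  have hs := Finset.sum_le_sum fun i (_ : i ∈ Finset.univ) => hle i
  rw [Finset.sum_add_distrib, Finset.sum_sub_distrib, Finset.sum_sub_distrib, ← Finset.sum_mul, h1,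
    ← Finset.mul_sum, Finset.sum_const, ← Nat.cast_sum, hsum, nsmul_eq_mul, Finset.card_univ] at hs
  have := (log_factorial_bounds M).1
  linarith

section
variable {σ : Type*} {p q : MvPolynomial σ ℝ}
open MvPolynomial

theorem coeff_mul_nonneg (hp : ∀ d, 0 ≤ p.coeff d) (hq : ∀ d, 0 ≤ q.coeff d) (d : σ →₀ ℕ) :
    0 ≤ (p * q).coeff d := by
  classical
  rw [coeff_mul]
  exact Finset.sum_nonneg fun x _ => mul_nonneg (hp _) (hq _)

theorem coeff_pow_nonneg (hp : ∀ d, 0 ≤ p.coeff d) (n : ℕ) (d : σ →₀ ℕ) :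
    0 ≤ (p ^ n).coeff d := by
  classical
  induction n generalizing d with
  | zero =>
    rw [pow_zero, coeff_one]
    split_ifs <;> norm_num
  | succ n ih =>
    rw [pow_succ]
    exact coeff_mul_nonneg ih hp d

theorem mul_coeff_le_coeff_mul (hp : ∀ d, 0 ≤ p.coeff d) (hq : ∀ d, 0 ≤ q.coeff d)
    (d e : σ →₀ ℕ) : p.coeff d * q.coeff e ≤ (p * q).coeff (d + e) := by
  classical
  rw [coeff_mul]
  exact Finset.single_le_sum (f := fun x : (σ →₀ ℕ) × (σ →₀ ℕ) => p.coeff x.1 * q.coeff x.2)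
    (fun x _ => mul_nonneg (hp _) (hq _)) (a := (d, e)) (by simp)

theorem coeff_mul_prod_le_eval [Fintype σ] (hp : ∀ d, 0 ≤ p.coeff d) {x : σ → ℝ} (hx : ∀ i, 0 ≤ x i)
    (d : σ →₀ ℕ) : p.coeff d * ∏ i, x i ^ d i ≤ eval x p := by
  rw [eval_eq']
  have h0 : ∀ d : σ →₀ ℕ, 0 ≤ p.coeff d * ∏ i, x i ^ d i := fun d =>
    mul_nonneg (hp d) (Finset.prod_nonneg fun i _ => pow_nonneg (hx i) _)
  by_cases hd : d ∈ p.support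
  · exact Finset.single_le_sum (f := fun d : σ →₀ ℕ => p.coeff d * ∏ i, x i ^ d i)
      (fun d _ => h0 d) hd
  · rw [notMem_support_iff.1 hd, zero_mul]
    exact Finset.sum_nonneg fun d _ => h0 d

theorem multinomial_mul_prod_le_coeff_pow (hp : ∀ d, 0 ≤ p.coeff d) (k : p.support → ℕ) {n : ℕ}
    (hk : ∑ d, k d = n) :
    (Nat.multinomial Finset.univ k : ℝ) * ∏ d, p.coeff d.1 ^ k d ≤
      (p ^ n).coeff (∑ d, k d • d.1) := by
  classical
  have hsum : p = ∑ d : p.support, monomial d.1 (p.coeff d.1) := by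
    conv_lhs => rw [p.as_sum]
    exact (Finset.sum_coe_sort p.support fun d => monomial d (p.coeff d)).symm
  have hterm : ∀ j : p.support → ℕ,
      (Nat.multinomial Finset.univ j : MvPolynomial σ ℝ) *
        ∏ d : p.support, monomial d.1 (p.coeff d.1) ^ j d
      = monomial (∑ d, j d • d.1)
        ((Nat.multinomial Finset.univ j : ℝ) * ∏ d : p.support, p.coeff d.1 ^ j d) := by
    intro j
    rw [← C_mul_monomial, monomial_sum_prod, map_natCast]
    simp only [monomial_pow]
  have hp' : p ^ n = ∑ j ∈ Finset.univ.piAntidiag n, monomial (∑ d, j d • d.1)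
      ((Nat.multinomial Finset.univ j : ℝ) * ∏ d : p.support, p.coeff d.1 ^ j d) := by
    conv_lhs => rw [hsum]
    rw [Finset.sum_pow_eq_sum_piAntidiag]
    exact Finset.sum_congr rfl fun j _ => hterm j
  have hnn : ∀ j : p.support → ℕ,
      0 ≤ (Nat.multinomial Finset.univ j : ℝ) * ∏ d : p.support, p.coeff d.1 ^ j d := fun j =>
    mul_nonneg (Nat.cast_nonneg _) (Finset.prod_nonneg fun d _ => pow_nonneg (hp _) _)
  rw [hp', coeff_sum]
  refine le_trans ?_ (Finset.single_le_sum (a := k) (fun j _ => ?_) (by simpa using hk))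
  · simp
  · rw [coeff_monomial]
    split_ifs
    exacts [hnn j, le_rfl]

theorem exists_coeff_pow_ge [Fintype σ] (hp : ∀ d, 0 ≤ p.coeff d) (hp0 : p ≠ 0) (α : σ → ℚ) {I : ℝ}
    (hI : ∀ t : σ → ℝ, I ≤ Real.log (∑ d : p.support,
      p.coeff d.1 * Real.exp (∑ j, t j * ((d.1 j : ℝ) - α j))))
    {ε : ℝ} (hε : 0 < ε) :
    ∃ n : ℕ, 0 < n ∧ ∃ A : σ →₀ ℕ, (∀ j, (A j : ℚ) = α j * n) ∧ 0 < (p ^ n).coeff A ∧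
      n * (I - ε) ≤ Real.log ((p ^ n).coeff A) := by
  have hne : Nonempty p.support := (support_nonempty.2 hp0).to_subtype
  have hw : ∀ d : p.support, 0 < p.coeff d.1 := fun d =>
    (hp _).lt_of_ne' (mem_support_iff.1 d.2)
  obtain ⟨l, ⟨hl0, hl1⟩, hent, hmean⟩ := exists_entropy_ge hw
    (fun d : p.support => (WithLp.toLp 2 fun j => (d.1 j : ℝ) - α j : EuclideanSpace ℝ σ)) (I := I)
    (fun t => by simpa [PiLp.inner_apply] using hI t)
  have hmean' : ∀ j, ∑ d : p.support, ((d.1 j - α j : ℚ) : ℝ) * l d = 0 := fun j => by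
    have := congrArg (fun x : EuclideanSpace ℝ σ => x j) hmean
    simpa [mul_comm] using this
  let F : (p.support → ℝ) → ℝ := fun μ =>
    ∑ d, (μ d * Real.log (p.coeff d.1) + Real.negMulLog (μ d))
  have hU : {μ : p.support → ℝ | 0 < ∑ d, μ d ∧ I - ε / 2 < F fun d => μ d / ∑ e, μ e} ∈ 𝓝 l := by
    have hF : Continuous F := by
      have := Real.continuous_negMulLog
      fun_prop
    have hn : ContinuousAt (fun (μ : p.support → ℝ) d => μ d / ∑ e, μ e) l := by
      refine continuousAt_pi.2 fun d => ContinuousAt.div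
        (continuous_apply d).continuousAt (by fun_prop) ?_
      rw [hl1]
      exact one_ne_zero
    have h1 : ContinuousAt (fun μ : p.support → ℝ => ∑ d, μ d) l := by fun_prop
    have h2 := (hF.continuousAt.comp (f := fun (μ : p.support → ℝ) d => μ d / ∑ e, μ e) hn)
    refine Filter.inter_mem (h1.eventually (lt_mem_nhds ?_)) (h2.eventually (lt_mem_nhds ?_))
    · exact one_pos.trans_eq hl1.symm
    · simp only [Function.comp, hl1, div_one]
      have : I ≤ F l := hent
      linarith
  obtain ⟨q, hq0, ⟨hqs, hqF⟩, hqrel⟩ := exists_rat_approx hl0 hU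
  have hqs' : 0 < ∑ d, q d := by
    simpa only [← Rat.cast_sum, Rat.cast_pos] using hqs
  obtain ⟨N, hN, k, hk⟩ := exists_nat_mul_eq (q := fun d => q d / ∑ e, q e)
    fun d => div_nonneg (hq0 d) hqs'.le
  obtain ⟨M₀, hM₀⟩ : ∃ M₀ : ℕ, ∀ M ≥ M₀,
      (Fintype.card p.support : ℝ) * (1 + Real.log M) ≤ ε / 2 * M := by
    have h1 : Tendsto (fun M : ℕ => (Fintype.card p.support : ℝ) *
        ((M : ℝ)⁻¹ + Real.log M / M)) atTop (𝓝 (Fintype.card p.support * (0 + 0))) := by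
      refine Tendsto.const_mul _ (tendsto_inv_atTop_nhds_zero_nat.add ?_)
      exact (Real.isLittleO_log_id_atTop.tendsto_div_nhds_zero).comp tendsto_natCast_atTop_atTop
    have h2 := h1.eventually_lt_const (u := ε / 2) (by simpa using half_pos hε)
    obtain ⟨M₀, h⟩ := eventually_atTop.1 (h2.and (eventually_gt_atTop 0))
    refine ⟨M₀, fun M hM => ?_⟩
    obtain ⟨h3, h4⟩ := h M hM
    have h4' : (0 : ℝ) < M := by exact_mod_cast h4
    calc _ = (Fintype.card p.support : ℝ) * ((M : ℝ)⁻¹ + Real.log M / M) * M := by field_simp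
      _ ≤ _ := by gcongr
  let M := (M₀ + 1) * N
  have hM : M₀ ≤ M := (Nat.le_succ M₀).trans (Nat.le_mul_of_pos_right _ hN)
  have hMpos : 0 < M := Nat.mul_pos M₀.succ_pos hN
  let κ : p.support → ℕ := fun d => (M₀ + 1) * k d
  have hκq : ∀ d, (κ d : ℚ) = M * (q d / ∑ e, q e) := fun d => by
    simp only [κ, M, Nat.cast_mul, hk]
    ring
  let μ : p.support → ℝ := fun d => (q d : ℝ) / ∑ e, (q e : ℝ)
  have hμ1 : ∑ d, μ d = 1 := by
    simp only [μ]
    rw [← Finset.sum_div]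
    exact div_self hqs.ne'
  have hκ : ∀ d, (κ d : ℝ) = M * μ d := fun d => by
    have := congrArg (Rat.cast : ℚ → ℝ) (hκq d)
    push_cast at this
    exact this
  have hκsum : ∑ d, κ d = M := by
    have : ((∑ d, κ d : ℕ) : ℝ) = M := by
      push_cast
      simp only [hκ]
      rw [← Finset.mul_sum, hμ1, mul_one]
    exact_mod_cast this
  have hle := multinomial_mul_prod_le_coeff_pow hp κ hκsum
  have hmpos : (0 : ℝ) < Nat.multinomial Finset.univ κ := by
    exact_mod_cast Nat.multinomial_pos _ _
  have hppos : 0 < ∏ d : p.support, p.coeff d.1 ^ κ d :=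
    Finset.prod_pos fun d _ => pow_pos (hw d) _
  have hpos := mul_pos hmpos hppos
  refine ⟨M, hMpos, ∑ d, κ d • d.1, fun j => ?_, hpos.trans_le hle, ?_⟩
  · have h1 := hqrel (fun d => (d.1 j : ℚ) - α j) (hmean' j)
    simp only [sub_mul, Finset.sum_sub_distrib] at h1
    rw [← Finset.mul_sum] at h1
    rw [Finsupp.finsetSum_apply]
    simp only [Finsupp.smul_apply, smul_eq_mul, Nat.cast_sum, Nat.cast_mul, hκq]
    have h2 : ∀ d : p.support, (M : ℚ) * (q d / ∑ e, q e) * (d.1 j : ℚ)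
        = M / (∑ e, q e) * (d.1 j * q d) := fun d => by ring
    simp only [h2]
    rw [← Finset.mul_sum, sub_eq_zero.1 h1]
    field_simp
  · refine le_trans ?_ (Real.log_le_log hpos hle)
    rw [Real.log_mul hmpos.ne' hppos.ne', Real.log_prod fun d _ => (pow_pos (hw d) _).ne']
    have h1 := log_multinomial_ge hμ1 κ hκ
    have h2 := hM₀ M hM
    have h3 : ∑ d : p.support, Real.log (p.coeff d.1 ^ κ d)
        = M * ∑ d, μ d * Real.log (p.coeff d.1) := by
      rw [Finset.mul_sum]
      refine Finset.sum_congr rfl fun d _ => ?_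
      rw [Real.log_pow, hκ]
      ring
    have h4 : I - ε / 2 < (∑ d, μ d * Real.log (p.coeff d.1)) + ∑ d, Real.negMulLog (μ d) := by
      rw [← Finset.sum_add_distrib]
      exact hqF
    have h5 := mul_le_mul_of_nonneg_left h4.le (Nat.cast_nonneg (α := ℝ) M)
    rw [h3]
    linarith

end

/-- **Coefficient growth of powers of a non-negative bivariate polynomial**
(Bennatan–Burshtein, Th. 10).  Let `p(x,y)` have non-negative coefficients and
`α, β > 0` be rationals.  Along the (strictly increasing, exhaustive) sequence
`s` of indices `n` for which `αn, βn` are integral and the coefficient of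
`x^{αn} y^{βn}` in `p^n` is nonzero, one has the Chernoff bound
`⌊p^n⌋_{αn,βn} ≤ p(x,y)^n/(x^{αn} y^{βn})` for all `x,y > 0`, and
`(1/n) log ⌊p^n⌋_{αn,βn} → log inf_{x,y>0} p(x,y)/(x^α y^β)`. -/
theorem coefficient_growth_nonneg_poly
    (p : MvPolynomial (Fin 2) ℝ)
    (hp : ∀ d, 0 ≤ p.coeff d)
    (α β : ℚ) (hα : 0 < α) (hβ : 0 < β)
    (s : ℕ → ℕ) (hs : StrictMono s)
    (a b : ℕ → ℕ)
    (ha : ∀ i, (a i : ℚ) = α * s i) (hb : ∀ i, (b i : ℚ) = β * s i)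
    (hnz : ∀ i,
      (p ^ s i).coeff (Finsupp.single 0 (a i) + Finsupp.single 1 (b i)) ≠ 0)
    (hall : ∀ n A B : ℕ, (A : ℚ) = α * n → (B : ℚ) = β * n →
      (p ^ n).coeff (Finsupp.single 0 A + Finsupp.single 1 B) ≠ 0 →
      n ∈ Set.range s) :
    (∀ i, ∀ x y : ℝ, 0 < x → 0 < y →
      (p ^ s i).coeff (Finsupp.single 0 (a i) + Finsupp.single 1 (b i))
        ≤ (MvPolynomial.eval (fun j : Fin 2 => if j = 0 then x else y) p) ^ s i /
            (x ^ a i * y ^ b i))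
    ∧ Tendsto
        (fun i => (s i : ℝ)⁻¹ *
          Real.log ((p ^ s i).coeff (Finsupp.single 0 (a i) + Finsupp.single 1 (b i))))
        atTop
        (𝓝 (Real.log (sInf {v : ℝ | ∃ x y : ℝ, 0 < x ∧ 0 < y ∧
          v = (MvPolynomial.eval (fun j : Fin 2 => if j = 0 then x else y) p) /
                (x ^ (α : ℝ) * y ^ (β : ℝ))}))) := by
  classical
  have hcher : ∀ i, ∀ x y : ℝ, 0 < x → 0 < y →
      (p ^ s i).coeff (Finsupp.single 0 (a i) + Finsupp.single 1 (b i))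
        ≤ (MvPolynomial.eval (fun j : Fin 2 => if j = 0 then x else y) p) ^ s i /
            (x ^ a i * y ^ b i) := by
    intro i x y hx hy
    rw [le_div_iff₀ (by positivity), ← map_pow]
    have := coeff_mul_prod_le_eval (coeff_pow_nonneg hp (s i))
      (x := fun j : Fin 2 => if j = 0 then x else y)
      (fun j => by split_ifs <;> positivity)
      (Finsupp.single 0 (a i) + Finsupp.single 1 (b i))
    simpa [Fin.prod_univ_two] using this
  refine ⟨hcher, ?_⟩
  let c : ℕ → ℝ := fun n => (p ^ n).coeff
    (Finsupp.single 0 ⌊α * n⌋₊ + Finsupp.single 1 ⌊β * n⌋₊)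
  have hc : ∀ n A B : ℕ, (A : ℚ) = α * n → (B : ℚ) = β * n →
      c n = (p ^ n).coeff (Finsupp.single 0 A + Finsupp.single 1 B) := by
    intro n A B hA hB
    simp only [c, ← hA, ← hB, Nat.floor_natCast]
  have hcs : ∀ i, c (s i) = (p ^ s i).coeff (Finsupp.single 0 (a i) + Finsupp.single 1 (b i)) :=
    fun i => hc _ _ _ (ha i) (hb i)
  have hcpos : ∀ i, 0 < c (s i) := fun i => by
    rw [hcs]
    exact (coeff_pow_nonneg hp _ _).lt_of_ne' (hnz i)
  simp only [← hcs]
  have hsuper : ∀ m ∈ Set.range s, ∀ n ∈ Set.range s, m + n ∈ Set.range s ∧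
      Real.log (c m) + Real.log (c n) ≤ Real.log (c (m + n)) := by
    rintro _ ⟨i, rfl⟩ _ ⟨j, rfl⟩
    have hA : ((a i + a j : ℕ) : ℚ) = α * (s i + s j : ℕ) := by
      push_cast
      rw [ha, ha]
      ring
    have hB : ((b i + b j : ℕ) : ℚ) = β * (s i + s j : ℕ) := by
      push_cast
      rw [hb, hb]
      ring
    have hmul : c (s i) * c (s j) ≤ c (s i + s j) := by
      rw [hc _ _ _ hA hB, hcs, hcs, pow_add, Finsupp.single_add, Finsupp.single_add,
        add_add_add_comm]
      exact mul_coeff_le_coeff_mul (coeff_pow_nonneg hp _) (coeff_pow_nonneg hp _) _ _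
    have hpos := mul_pos (hcpos i) (hcpos j)
    refine ⟨hall _ _ _ hA hB ?_, ?_⟩
    · rw [← hc _ _ _ hA hB]
      exact (hpos.trans_le hmul).ne'
    · rw [← Real.log_mul (hcpos i).ne' (hcpos j).ne']
      exact Real.log_le_log hpos hmul
  set V : Set ℝ := {v : ℝ | ∃ x y : ℝ, 0 < x ∧ 0 < y ∧
    v = (MvPolynomial.eval (fun j : Fin 2 => if j = 0 then x else y) p) /
      (x ^ (α : ℝ) * y ^ (β : ℝ))} with hV
  have hVne : V.Nonempty := ⟨_, 1, 1, one_pos, one_pos, rfl⟩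
  have hVge : ∀ i, 0 < s i → ∀ v ∈ V, Real.exp ((s i : ℝ)⁻¹ * Real.log (c (s i))) ≤ v := by
    rintro i hi v ⟨x, y, hx, hy, rfl⟩
    have hi' : (0 : ℝ) < s i := by exact_mod_cast hi
    have hai : (a i : ℝ) = α * s i := by exact_mod_cast congrArg (Rat.cast : ℚ → ℝ) (ha i)
    have hbi : (b i : ℝ) = β * s i := by exact_mod_cast congrArg (Rat.cast : ℚ → ℝ) (hb i)
    have hev : 0 ≤ MvPolynomial.eval (fun j : Fin 2 => if j = 0 then x else y) p := by
      rw [MvPolynomial.eval_eq']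
      refine Finset.sum_nonneg fun d _ => mul_nonneg (hp d) (Finset.prod_nonneg fun j _ => ?_)
      split_ifs <;> positivity
    have h := hcher i x y hx hy
    rw [← hcs, ← Real.rpow_natCast x, ← Real.rpow_natCast y, hai, hbi, Real.rpow_mul hx.le,
      Real.rpow_mul hy.le, Real.rpow_natCast, Real.rpow_natCast, ← mul_pow, ← div_pow] at h
    have hexp : Real.exp ((s i : ℝ)⁻¹ * Real.log (c (s i))) ^ s i = c (s i) := by
      rw [← Real.exp_nat_mul, mul_inv_cancel_left₀ hi'.ne', Real.exp_log (hcpos i)]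
    rw [← hexp] at h
    exact le_of_pow_le_pow_left₀ hi.ne' (div_nonneg hev (by positivity)) h
  have hexp_le : ∀ i, 0 < s i → Real.exp ((s i : ℝ)⁻¹ * Real.log (c (s i))) ≤ sInf V :=
    fun i hi => le_csInf hVne (hVge i hi)
  have hs1 : 0 < s 1 := (Nat.zero_le _).trans_lt (hs zero_lt_one)
  have hJ : 0 < sInf V := (Real.exp_pos _).trans_le (hexp_le 1 hs1)
  have hbdd : BddBelow V := ⟨_, hVge 1 hs1⟩
  have hp0 : p ≠ 0 := by
    rintro rfl
    exact hnz 1 (by simp [zero_pow hs1.ne'])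
  have hI : ∀ t : Fin 2 → ℝ, Real.log (sInf V) ≤ Real.log (∑ d : p.support,
      p.coeff d.1 * Real.exp (∑ j, t j * ((d.1 j : ℝ) - (![α, β] j : ℚ)))) := by
    intro t
    refine Real.log_le_log hJ (csInf_le hbdd ⟨Real.exp (t 0), Real.exp (t 1), Real.exp_pos _,
      Real.exp_pos _, ?_⟩)
    rw [MvPolynomial.eval_eq', Finset.sum_div, ← Finset.sum_coe_sort p.support]
    refine Finset.sum_congr rfl fun d _ => ?_
    rw [← Real.exp_mul, ← Real.exp_mul, ← Real.exp_add, mul_div_assoc]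
    congr 1
    simp only [Fin.prod_univ_two, Fin.sum_univ_two, if_true, one_ne_zero, if_false, Fin.isValue,
      Matrix.cons_val_zero, Matrix.cons_val_one]
    rw [← Real.exp_nat_mul, ← Real.exp_nat_mul, ← Real.exp_add, ← Real.exp_sub]
    congr 1
    ring
  have hsinf : Tendsto s atTop atTop := hs.tendsto_atTop
  refine tendsto_order.2 ⟨fun r hr => ?_, fun r hr => ?_⟩
  · obtain ⟨m, hm, A, hA, hApos, hAle⟩ :=
      exists_coeff_pow_ge hp hp0 ![α, β] hI (half_pos (sub_pos.2 hr))
    have hAeq : A = Finsupp.single 0 (A 0) + Finsupp.single 1 (A 1) := by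
      ext j
      fin_cases j <;> simp
    have hA0 : (A 0 : ℚ) = α * m := by simpa using hA 0
    have hA1 : (A 1 : ℚ) = β * m := by simpa using hA 1
    have hcm : c m = (p ^ m).coeff A := by
      rw [hc _ _ _ hA0 hA1, ← hAeq]
    have hmS : m ∈ Set.range s := hall m _ _ hA0 hA1 (by
      rw [← hAeq]
      exact hApos.ne')
    obtain ⟨C, hC⟩ := superadditive_lower_bound (u := fun n => Real.log (c n)) hsuper hmS hm
    have hm' : (0 : ℝ) < m := by exact_mod_cast hm
    have hrm : r < Real.log (c m) / m := by
      rw [lt_div_iff₀ hm', hcm]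
      refine lt_of_lt_of_le ?_ hAle
      rw [mul_comm]
      gcongr
      linarith
    have hlim : Tendsto (fun i => Real.log (c m) / m - C * (s i : ℝ)⁻¹) atTop
        (𝓝 (Real.log (c m) / m - C * 0)) :=
      ((tendsto_inv_atTop_nhds_zero_nat.comp hsinf).const_mul C).const_sub _
    filter_upwards [hlim.eventually (lt_mem_nhds (by simpa using hrm)),
      hsinf.eventually (eventually_gt_atTop 0)] with i hi hi0
    have hi' : (0 : ℝ) < s i := by exact_mod_cast hi0
    refine hi.trans_le ?_
    have := mul_le_mul_of_nonneg_left (hC (s i) ⟨i, rfl⟩) (inv_nonneg.2 hi'.le)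
    rw [mul_sub, inv_mul_cancel_left₀ hi'.ne', mul_comm _ C] at this
    exact this
  · filter_upwards [hsinf.eventually (eventually_gt_atTop 0)] with i hi
    exact ((Real.le_log_iff_exp_le hJ).2 (hexp_le i hi)).trans_lt hr
end
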